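/- arXiv:2405.10609 — 2 statements merged into one kernel-verified Lean document; each statement's English description precedes it below -/
import Mathlib

section
/- Let O be a W-orbit in ℝ^r and t ∈ T_O. There is a unique left action of W = W_0 ⋉ ℤ^r on F[O] by F-linear automorphisms, written g ↦ g_t, such that w_t(x^y) = x^{wy} for all w ∈ W_0 and τ(λ)_t(x^y) = (g_yt)^{−λ}·x^y for all λ ∈ ℤ^r and y ∈ O. Moreover this action satisfies the compatibility g_t(p·f) = (gp)·(g_tf) for all g ∈ W, p ∈ F[ℤ^r] and f ∈ F[O], where F[ℤ^r] := span_F{x^μ : μ ∈ ℤ^r} and W acts on F[ℤ^r] by algebra automorphisms via w(x^μ) := x^{wμ} (w ∈ W_0) and τ(λ)(x^μ) := q^{−⟨μ,λ⟩}·x^μ. -/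
open scoped Classical

noncomputable section

namespace QP

/-! ### The space of quasi-polynomials -/

/-- Euclidean space `ℝ^r`. -/
abbrev E (r : ℕ) := Fin r → ℝ

variable (F : Type*) [Field F] [CharZero F] (r : ℕ)

/-- The algebra of quasi-polynomials `F[ℝ^r]`: the group algebra of `(ℝ^r,+)` over `F`. -/
abbrev QA := AddMonoidAlgebra F (E r)

/-- The quasi-monomial `x^y`. -/
def X (y : E r) : QA F r := AddMonoidAlgebra.single y 1

/-- The `i`-th coordinate of a vector (`1`-based). -/
def cd (y : E r) (i : ℕ) : ℝ := ∑ m : Fin r, if (m : ℕ) + 1 = i then y m else 0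

/-- The standard basis vector `ε_i` (`1`-based). -/
def epsV (i : ℕ) : E r := fun m => if (m : ℕ) + 1 = i then 1 else 0

/-- The standard basis vector (`0`-based). -/
def eV (m : Fin r) : E r := fun n => if n = m then 1 else 0

/-- The Euclidean inner product on `ℝ^r`. -/
def ip (v y : E r) : ℝ := ∑ m : Fin r, v m * y m

/-- An integral vector regarded as an element of `ℝ^r`. -/
def zc (lam : Fin r → ℤ) : E r := fun m => (lam m : ℝ)

/-- The simple reflections of the hyperoctahedral group `W₀ = S_r ⋉ (±1)^r` (`1`-based):
for `1 ≤ i < r`, `sW i` interchanges the `i`-th and `(i+1)`-st coordinates, and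
`sW r` negates the last coordinate. -/
def sW (i : ℕ) (y : E r) : E r := fun m =>
  if i = r then (if (m : ℕ) + 1 = r then -y m else y m)
  else if (m : ℕ) + 1 = i then cd r y (i + 1)
  else if (m : ℕ) = i then cd r y i
  else y m

/-- `s_{ε₁} = s₁⋯s_{r-1} s_r s_{r-1}⋯s₁`: negation of the first coordinate. -/
def sEps1 (y : E r) : E r := fun m => if (m : ℕ) = 0 then -y m else y m

/-- The affine simple reflection `s₀ = τ(ε₁) s_{ε₁} : y ↦ (1 - y₁, y₂, …, y_r)`, together
with `genF j = sW j` for `1 ≤ j ≤ r`: the Coxeter generators of the affine Weyl group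
`W = W₀ ⋉ ℤ^r`. -/
def genF (j : ℕ) (y : E r) : E r :=
  if j = 0 then fun m => if (m : ℕ) = 0 then 1 - y m else y m
  else sW r j y

/-- The action of the word `s_{j₁} ⋯ s_{j_ℓ}` on `ℝ^r`. -/
def wordAct (l : List ℕ) (y : E r) : E r := l.foldr (genF r) y

/-- The closure of the fundamental alcove
`C₊ = {y : 0 < y_r < ⋯ < y₁ < 1/2}`. -/
def CplusCl : Set (E r) :=
  {y | (∀ i j : Fin r, i ≤ j → y j ≤ y i) ∧ ∀ m : Fin r, 0 ≤ y m ∧ y m ≤ 1 / 2}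

/-- The `W`-orbit of a point of `ℝ^r`. -/
def orbit (y : E r) : Set (E r) :=
  {z | ∃ l : List ℕ, (∀ a ∈ l, a ≤ r) ∧ wordAct r l y = z}

/-- `O` is a `W`-orbit in `ℝ^r`. -/
def IsOrbit (O : Set (E r)) : Prop := ∃ y, O = orbit r y

/-- `c^𝒪`: the unique point of the orbit `O` lying in the closed fundamental alcove. -/
def cpt (O : Set (E r)) : E r :=
  if h : ∃ c, c ∈ O ∧ c ∈ CplusCl r then h.choose else 0

/-- The length of an element of the affine Weyl group `W` (as a map on `ℝ^r`). -/
def wlen (g : E r → E r) : ℕ :=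
  sInf {n | ∃ l : List ℕ, (∀ a ∈ l, a ≤ r) ∧ l.length = n ∧ (fun y => wordAct r l y) = g}

/-- A choice of a shortest word `l` whose inverse maps `y` into the closed alcove;
the corresponding element of `W` is `g_y`. -/
def gW (y : E r) : List ℕ :=
  if h : ∃ l : List ℕ, (∀ a ∈ l, a ≤ r) ∧ wordAct r l.reverse y ∈ CplusCl r ∧
      ∀ l' : List ℕ, (∀ a ∈ l', a ≤ r) → wordAct r l'.reverse y ∈ CplusCl r →
        l.length ≤ l'.length
  then h.choose else []

/-- `g_y`, the unique shortest element of `W` with `g_y⁻¹ y` in the closed alcove. -/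
def gfun (y : E r) : E r → E r := fun z => wordAct r (gW r y) z

/-- The Bruhat order on `(W, {s₀,…,s_r})`, via the subword characterisation. -/
def bruhatLE (u v : E r → E r) : Prop :=
  ∃ l : List ℕ, (∀ a ∈ l, a ≤ r) ∧ (fun z => wordAct r l z) = v ∧ l.length = wlen r v ∧
    ∃ l' : List ℕ, l'.Sublist l ∧ (fun z => wordAct r l' z) = u ∧ l'.length = wlen r u

/-- The partial order on `ℝ^r`: `y' ≤ y` iff `y'` and `y` lie in the same `W`-orbit and
`g_{y'} ≤_B g_y` in the Bruhat order. -/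
def qle (y' y : E r) : Prop :=
  (∃ l : List ℕ, (∀ a ∈ l, a ≤ r) ∧ wordAct r l y = y') ∧ bruhatLE r (gfun r y') (gfun r y)

/-- Strict version of `qle`. -/
def qlt (y' y : E r) : Prop := qle r y' y ∧ y' ≠ y

/-- The `F`-linear operator on `F[ℝ^r]` determined by its values on the quasi-monomials. -/
def mkOp (Ψ : E r → QA F r) : Module.End F (QA F r) :=
  Finsupp.linearCombination F Ψ ∘ₗ (AddMonoidAlgebra.coeffLinearEquiv F).toLinearMap

/-- `F[O] = span_F {x^y : y ∈ O}`. -/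
def FO (O : Set (E r)) : Submodule F (QA F r) :=
  Submodule.span F {p | ∃ y ∈ O, p = X F r y}

/-- The Laurent polynomial subalgebra `F[ℤ^r] = span_F {x^μ : μ ∈ ℤ^r}`. -/
def Lspan : Submodule F (QA F r) :=
  Submodule.span F {p | ∃ lam : Fin r → ℤ, p = X F r (zc r lam)}

/-- `span_F {x^{y'} : y' < y}`. -/
def ltSpan (y : E r) : Submodule F (QA F r) :=
  Submodule.span F {p | ∃ y', qlt r y' y ∧ p = X F r y'}

/-! ### Floors and indicator/sign functions -/

/-- the largest even integer `≤ z` -/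
def floorE (z : ℝ) : ℤ := 2 * ⌊z / 2⌋
/-- the largest odd integer `≤ z` -/
def floorO (z : ℝ) : ℤ := 2 * ⌊(z + 1) / 2⌋ - 1
/-- indicator of `ℤ ⊆ ℝ` -/
def chiZ (z : ℝ) : ℕ := if ∃ n : ℤ, z = n then 1 else 0
/-- indicator of the even integers -/
def chiE (z : ℝ) : ℕ := if ∃ n : ℤ, z = 2 * n then 1 else 0
/-- indicator of the odd integers -/
def chiO (z : ℝ) : ℕ := if ∃ n : ℤ, z = 2 * n + 1 then 1 else 0
/-- `η_e`: `1` on even integers `≥ 2`, `-1` on even integers `≤ 0`, `0` otherwise -/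
def etaE (z : ℝ) : ℤ := if ∃ n : ℤ, z = 2 * n then (if 2 ≤ z then 1 else -1) else 0
/-- `η_o`: `1` on odd integers `≥ 1`, `-1` on odd integers `≤ -1`, `0` otherwise -/
def etaO (z : ℝ) : ℤ := if ∃ n : ℤ, z = 2 * n + 1 then (if 1 ≤ z then 1 else -1) else 0
/-- `η = η_e + η_o` -/
def eta (z : ℝ) : ℤ := etaE z + etaO z

/-- `geomS c v m` is the truncated geometric series `(1 - (c·x^v)^m)/(1 - c·x^v)`,
a genuine element of `F[ℝ^r]`; it is the unique element with
`(1 - c·x^v) * geomS c v m = 1 - c^m·x^{m v}`. -/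
def geomS (c : F) (v : E r) (m : ℤ) : QA F r :=
  if 0 ≤ m then ∑ t ∈ Finset.range m.toNat, c ^ (t : ℤ) • X F r ((t : ℝ) • v)
  else -∑ t ∈ Finset.range (-m).toNat, c ^ (-(t : ℤ) - 1) • X F r ((-(t : ℝ) - 1) • v)

/-! ### Truncated divided difference operators and Demazure–Lusztig operators -/

/-- `∇_i(x^y) = ((1 - (x_{i+1}/x_i)^{⌊y_i - y_{i+1}⌋})/(1 - x_i/x_{i+1}))·x^y`. -/
def nablaIel (i : ℕ) (y : E r) : QA F r :=
  geomS F r 1 (epsV r i - epsV r (i + 1)) (-⌊cd r y i - cd r y (i + 1)⌋) * X F r y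

/-- `∇_r^e(x^y) = ((1 - x_r^{-⌊2y_r⌋_e})/(1 - x_r^2))·x^y`. -/
def nablaReEl (y : E r) : QA F r :=
  geomS F r 1 ((2 : ℝ) • epsV r r) (-floorE (2 * cd r y r) / 2) * X F r y

/-- `∇_r^o(x^y) = ((x_r - x_r^{-⌊2y_r⌋_o})/(1 - x_r^2))·x^y`. -/
def nablaRoEl (y : E r) : QA F r :=
  X F r (epsV r r) *
    geomS F r 1 ((2 : ℝ) • epsV r r) ((-floorO (2 * cd r y r) - 1) / 2) * X F r y

def nablaIop (i : ℕ) : Module.End F (QA F r) := mkOp F r (nablaIel F r i)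
def nablaReOp : Module.End F (QA F r) := mkOp F r (nablaReEl F r)
def nablaRoOp : Module.End F (QA F r) := mkOp F r (nablaRoEl F r)

/-- The value of the truncated Demazure–Lusztig operator `T_i` (`1 ≤ i ≤ r`) on `x^y`. -/
def Tel (k kr ur : F) (i : ℕ) (y : E r) : QA F r :=
  if i = r then
    (kr ^ chiE (2 * cd r y r) * ur ^ chiO (2 * cd r y r)) • X F r (sW r r y)
      + (kr - kr⁻¹) • nablaReEl F r y + (ur - ur⁻¹) • nablaRoEl F r y
  else
    k ^ chiZ (cd r y i - cd r y (i + 1)) • X F r (sW r i y)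
      + (k - k⁻¹) • nablaIel F r i y

/-- The truncated Demazure–Lusztig operators `T_1, …, T_r` on `F[ℝ^r]`. -/
def Top (k kr ur : F) (i : ℕ) : Module.End F (QA F r) := mkOp F r (Tel F r k kr ur i)

/-! ### The torus and the affine generator -/

/-- `t^{ε_i}`: the `i`-th coordinate (`1`-based) of an element of the torus `T = (Fˣ)^r`. -/
def tcU (t : Fin r → Fˣ) (i : ℕ) : Fˣ := ∏ m : Fin r, if (m : ℕ) + 1 = i then t m else 1

/-- `t^λ` for `λ ∈ ℤ^r`. -/
def upow (t : Fin r → Fˣ) (lam : Fin r → ℤ) : Fˣ := ∏ m : Fin r, t m ^ lam m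

/-- `t^v` for a vector `v` with integral entries (entries read off via the floor). -/
def upowR (t : Fin r → Fˣ) (v : E r) : Fˣ := ∏ m : Fin r, t m ^ ⌊v m⌋

/-- The `W`-action on the torus `T = (Fˣ)^r`: for `g = τ(λ)w₀ ∈ W` (so `g y = w₀ y + λ`),
`(g t)_m = q^{λ_m} · t^{w₀⁻¹ ε_m}`, where `W₀` permutes and inverts coordinates and
`τ(λ) t = q^λ t`, with `q = (q^{1/2})²`. -/
def torusAct (qh : Fˣ) (g : E r → E r) (t : Fin r → Fˣ) : Fin r → Fˣ := fun m =>
  (qh * qh) ^ ⌊g 0 m⌋ * ∏ j : Fin r, t j ^ ⌊(g (eV r j) - g 0) m⌋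

/-- The action on the torus of the linear part of `g` alone (the `W₀`-action). -/
def torusAct0 (g : E r → E r) (t : Fin r → Fˣ) : Fin r → Fˣ := fun m =>
  ∏ j : Fin r, t j ^ ⌊(g (eV r j) - g 0) m⌋

/-- The simple affine roots `α₀(y) = 1 - 2y₁`, `α_i(y) = y_i - y_{i+1}` (`1 ≤ i < r`),
`α_r(y) = 2 y_r` as affine-linear functionals. -/
def alphaF (j : ℕ) (y : E r) : ℝ :=
  if j = 0 then 1 - 2 * cd r y 1
  else if j = r then 2 * cd r y r
  else cd r y j - cd r y (j + 1)

/-- `t^{α_j^∨}` where `α₀^∨ = (-ε₁, 1/2)`, `α_i^∨ = (ε_i - ε_{i+1}, 0)`, `α_r^∨ = (ε_r, 0)`. -/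
def tpowCo (qh : Fˣ) (t : Fin r → Fˣ) (j : ℕ) : Fˣ :=
  if j = 0 then qh * (tcU F r t 1)⁻¹
  else if j = r then tcU F r t r
  else tcU F r t j * (tcU F r t (j + 1))⁻¹

/-- The affine subtorus `T_𝒪 = {t ∈ T : t^{α_j^∨} = 1 whenever α_j(c^𝒪) = 0}`. -/
def TOset (qh : Fˣ) (O : Set (E r)) : Set (Fin r → Fˣ) :=
  {t | ∀ j : ℕ, j ≤ r → alphaF r j (cpt r O) = 0 → tpowCo F r qh t j = 1}

/-- `∇₀^e(x^y) = ((1 - (q^{-1/2}x₁)^{⌊-2y₁⌋_e})/(1 - q x₁^{-2}))·x^y`. -/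
def nabla0eEl (qh : F) (y : E r) : QA F r :=
  geomS F r (qh * qh) ((-2 : ℝ) • epsV r 1) (-floorE (-2 * cd r y 1) / 2) * X F r y

/-- `∇₀^o(x^y) = ((q^{1/2}x₁^{-1} - (q^{-1/2}x₁)^{⌊-2y₁⌋_o})/(1 - q x₁^{-2}))·x^y`. -/
def nabla0oEl (qh : F) (y : E r) : QA F r :=
  (qh • X F r ((-1 : ℝ) • epsV r 1)) *
    geomS F r (qh * qh) ((-2 : ℝ) • epsV r 1) ((-floorO (-2 * cd r y 1) - 1) / 2) * X F r y

/-- The value of `T₀^𝒪` on `x^y`. -/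
def T0el (qh : Fˣ) (k0 u0 : F) (t : Fin r → Fˣ) (y : E r) : QA F r :=
  (k0 ^ chiE (2 * cd r y 1) * u0 ^ chiO (2 * cd r y 1) *
      ((tcU F r (torusAct F r qh (gfun r y) t) 1 : Fˣ) : F)) • X F r (sEps1 r y)
    + (k0 - k0⁻¹) • nabla0eEl F r qh y + (u0 - u0⁻¹) • nabla0oEl F r qh y

/-- The operator `T₀^𝒪` (as a globally defined operator; on `F[𝒪]` it is the operator of
the quasi-polynomial representation). -/
def T0op (qh : Fˣ) (k0 u0 : F) (t : Fin r → Fˣ) : Module.End F (QA F r) :=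
  mkOp F r (T0el F r qh k0 u0 t)

/-- The full family `T₀^𝒪, T₁, …, T_r`. -/
def Tfull (qh : Fˣ) (k0 u0 k kr ur : F) (t : Fin r → Fˣ) (j : ℕ) : Module.End F (QA F r) :=
  if j = 0 then T0op F r qh k0 u0 t else Top F r k kr ur j

/-- The Hecke parameter `k_j` (`k₀`, `k` or `k_r`). -/
def kpar (k0 k kr : F) (j : ℕ) : F := if j = 0 then k0 else if j = r then kr else k

/-- `(T_j^𝒪)⁻¹ = T_j^𝒪 - k_j + k_j⁻¹` (the inverse on `F[𝒪]`, by the Hecke relation). -/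
def TfullInv (qh : Fˣ) (k0 u0 k kr ur : F) (t : Fin r → Fˣ) (j : ℕ) : Module.End F (QA F r) :=
  Tfull F r qh k0 u0 k kr ur t j - (kpar F r k0 k kr j - (kpar F r k0 k kr j)⁻¹) • 1

/-- The word `0, 1, …, r-1, r, r-1, …, i` used in the definition of `Y_i^𝒪`. -/
def Ylist (i : ℕ) : List ℕ :=
  0 :: (((List.range (r - 1)).map (· + 1)) ++ [r] ++ ((List.range (r - i)).map fun m => r - 1 - m))

/-- The commuting operators
`Y_i^𝒪 = (T_{i-1}^𝒪)⁻¹⋯(T₁^𝒪)⁻¹ · T₀^𝒪 · T₁^𝒪⋯T_{r-1}^𝒪 · T_r^𝒪 · T_{r-1}^𝒪⋯T_i^𝒪`. -/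
def Yop (qh : Fˣ) (k0 u0 k kr ur : F) (t : Fin r → Fˣ) (i : ℕ) : Module.End F (QA F r) :=
  ((((List.range (i - 1)).map (· + 1)).reverse.map (TfullInv F r qh k0 u0 k kr ur t)).prod) *
    (((Ylist r i).map (Tfull F r qh k0 u0 k kr ur t)).prod)

/-! ### The base points `𝔰^𝒪`, `𝔰_y` and the spectrum -/

/-- `n_i^𝒪` (with `c = c^𝒪`), resp. `m_i(y)` (with `c = y`). -/
def nO (c : E r) (m : Fin r) : ℤ :=
  (∑ j : Fin r, if m < j then eta (c m - c j) + eta (c m + c j) else 0) +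
    ∑ j : Fin r, if j < m then eta (c j + c m) - eta (c j - c m) else 0

/-- The base point `𝔰^𝒪 ∈ T`. -/
def sOtor (k0 u0 k kr ur : Fˣ) (O : Set (E r)) : Fin r → Fˣ := fun m =>
  (k0 * kr) ^ (-(chiE (2 * cpt r O m) : ℤ)) * (u0 * ur) ^ (chiO (2 * cpt r O m) : ℤ) *
    k ^ nO r (cpt r O) m

/-- The eigenvalue `γ_i^𝒪(y) = ((g_y(𝔰^𝒪·t))_i)⁻¹`. -/
def gammaO (qh k0 u0 k kr ur : Fˣ) (O : Set (E r)) (t : Fin r → Fˣ) (i : ℕ) (y : E r) : Fˣ :=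
  (tcU F r (torusAct F r qh (gfun r y) fun m => sOtor F r k0 u0 k kr ur O m * t m) i)⁻¹

/-- `𝔰_y ∈ T`. -/
def sfrak (k0 u0 k kr ur : Fˣ) (y : E r) : Fin r → Fˣ := fun m =>
  (k0 * kr) ^ etaE (2 * y m) * (u0 * ur) ^ etaO (2 * y m) * k ^ nO r y m

/-! ### Finite Weyl group combinatorics, positive roots -/

/-- The set of positive roots of type `C_r`. -/
def PhiPlus : Set (E r) :=
  {v | (∃ a b : Fin r, a < b ∧ v = eV r a - eV r b) ∨
       (∃ a b : Fin r, a < b ∧ v = eV r a + eV r b) ∨ ∃ a : Fin r, v = (2 : ℝ) • eV r a}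

/-- The root system of type `C_r`. -/
def Phi0 : Set (E r) := PhiPlus r ∪ {v | -v ∈ PhiPlus r}

/-- The normalisation factor `κ_w^𝒪 = ∏_{α ∈ Π(w)} 𝐤_α^{χ_e(α(c))}·𝐤_{α/2}^{-χ_o(α(c))}`,
where `Π(w) = {α ∈ Φ₀⁺ : wα ∈ -Φ₀⁺}`, `𝐤_α = 𝐤_{α/2} = k` for short roots and
`𝐤_α = k_r`, `𝐤_{α/2} = u_r` for long roots. -/
def kappaW (k kr ur : Fˣ) (w : E r → E r) (c : E r) : Fˣ :=
  (∏ p : Fin r × Fin r,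
      if p.1 < p.2 ∧ -w (eV r p.1 - eV r p.2) ∈ PhiPlus r then
        k ^ ((chiE (ip r (eV r p.1 - eV r p.2) c) : ℤ) - (chiO (ip r (eV r p.1 - eV r p.2) c) : ℤ))
      else 1) *
  (∏ p : Fin r × Fin r,
      if p.1 < p.2 ∧ -w (eV r p.1 + eV r p.2) ∈ PhiPlus r then
        k ^ ((chiE (ip r (eV r p.1 + eV r p.2) c) : ℤ) - (chiO (ip r (eV r p.1 + eV r p.2) c) : ℤ))
      else 1) *
  ∏ a : Fin r,
      if -w ((2 : ℝ) • eV r a) ∈ PhiPlus r then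
        kr ^ (chiE (ip r ((2 : ℝ) • eV r a) c) : ℤ) * ur ^ (-(chiO (ip r ((2 : ℝ) • eV r a) c) : ℤ))
      else 1

/-- Iterated application `T_{i₁}(T_{i₂}(⋯(T_{i_ℓ}(f))⋯))`. -/
def applyT (k kr ur : F) (l : List ℕ) (f : QA F r) : QA F r :=
  l.foldr (fun i g => Top F r k kr ur i g) f

/-- The length function of the finite Weyl group `W₀`. -/
def w0len (g : E r → E r) : ℕ :=
  sInf {n | ∃ l : List ℕ, (∀ a ∈ l, 1 ≤ a ∧ a ≤ r) ∧ l.length = n ∧ (fun y => wordAct r l y) = g}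

/-- Membership in `W₀` (as maps on `ℝ^r`). -/
def IsW0fun (w : E r → E r) : Prop :=
  ∃ l : List ℕ, (∀ a ∈ l, 1 ≤ a ∧ a ≤ r) ∧ w = fun y => wordAct r l y

/-- Membership in the parabolic subgroup `W_{0,𝒪}` generated by the `s_i`, `1 ≤ i ≤ r`,
with `α_i(c^𝒪) = 0`. -/
def IsWOOfun (O : Set (E r)) (u : E r → E r) : Prop :=
  ∃ l : List ℕ, (∀ a ∈ l, 1 ≤ a ∧ a ≤ r ∧ alphaF r a (cpt r O) = 0) ∧
    u = fun y => wordAct r l y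

/-- `v ∈ W₀^𝒪`: `v ∈ W₀` of minimal length in its coset `v·W_{0,𝒪}`. -/
def MinRep (O : Set (E r)) (v : E r → E r) : Prop :=
  IsW0fun r v ∧ ∀ u, IsWOOfun r O u → w0len r v ≤ w0len r fun y => v (u y)

/-- Membership in the affine Weyl group `W` (as maps on `ℝ^r`). -/
def IsWfun (g : E r → E r) : Prop :=
  ∃ l : List ℕ, (∀ a ∈ l, a ≤ r) ∧ g = fun y => wordAct r l y

/-- Membership in the parabolic subgroup `W_{J(𝒪)}` generated by the `s_j`, `j ∈ J(𝒪)`. -/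
def IsWJfun (O : Set (E r)) (u : E r → E r) : Prop :=
  ∃ l : List ℕ, (∀ a ∈ l, a ≤ r ∧ alphaF r a (cpt r O) = 0) ∧ u = fun y => wordAct r l y

/-- The `W`-action on the Laurent polynomials `F[ℤ^r]` by `q`-dilations and reflections:
`w(x^μ) = x^{wμ}` for `w ∈ W₀`, `τ(λ)(x^μ) = q^{-⟨μ,λ⟩} x^μ` (globally defined via the
linear/translation parts of `g`). -/
def LWact (qh : Fˣ) (g : E r → E r) : Module.End F (QA F r) :=
  mkOp F r fun v => (((qh * qh) ^ (-⌊ip r (g v - g 0) (g 0)⌋) : Fˣ) : F) • X F r (g v - g 0)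

/-! ### roots `ᾱ_j`, torus reflections -/

/-- The finite simple roots `ᾱ₀ = -2ε₁`, `ᾱ_i = ε_i - ε_{i+1}`, `ᾱ_r = 2ε_r`
(as integral vectors). -/
def abarI (j : ℕ) : Fin r → ℤ := fun m =>
  if j = 0 then (if (m : ℕ) = 0 then -2 else 0)
  else if j = r then (if (m : ℕ) + 1 = r then 2 else 0)
  else if (m : ℕ) + 1 = j then 1
  else if (m : ℕ) = j then -1
  else 0

/-- The corresponding coroots `ᾱ₀^∨ = -ε₁`, `ᾱ_i^∨ = ε_i - ε_{i+1}`, `ᾱ_r^∨ = ε_r`. -/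
def abarV (j : ℕ) : Fin r → ℤ := fun m =>
  if j = 0 then (if (m : ℕ) = 0 then -1 else 0)
  else if j = r then (if (m : ℕ) + 1 = r then 1 else 0)
  else if (m : ℕ) + 1 = j then 1
  else if (m : ℕ) = j then -1
  else 0

/-- `ᾱ_j` as a real vector. -/
def abarR (j : ℕ) : E r := fun m => ((abarI r j m : ℤ) : ℝ)

/-- The constants `c₀ = u₀u_r`, `c_i = k²`, `c_r = k₀k_r`. -/
def cpar (k0 u0 k kr ur : Fˣ) (j : ℕ) : Fˣ :=
  if j = 0 then u0 * ur else if j = r then k0 * kr else k * k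

/-- The action of the reflection `s_{ᾱ_j} ∈ W₀` on the torus `T` (with `s_{ᾱ₀} = s_{ε₁}`). -/
def sTor (j : ℕ) (t : Fin r → Fˣ) : Fin r → Fˣ := fun m =>
  if j = 0 then (if (m : ℕ) = 0 then (t m)⁻¹ else t m)
  else if j = r then (if (m : ℕ) + 1 = r then (t m)⁻¹ else t m)
  else if (m : ℕ) + 1 = j then tcU F r t (j + 1)
  else if (m : ℕ) = j then tcU F r t j
  else t m

/-! ### The operators `G_t^𝒪(a)` for affine roots `a = (α, n)` -/

/-- The coroot `α^∨ = 2α/⟨α,α⟩`. -/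
def coroot (v : E r) : E r := ((2 : ℝ) / ip r v v) • v

/-- The scalar `q^{2n/⟨α,α⟩}` appearing in `x^{a^∨}` for `a = (α,n)`. -/
def qsc (qh : Fˣ) (v : E r) (n : ℤ) : Fˣ := if ip r v v = 4 then qh ^ n else (qh * qh) ^ n

/-- `𝐤_a`: `k` if `α` is short; `k_r` if `α` long, `n` even; `k₀` if `α` long, `n` odd. -/
def kaf (k0 k kr : Fˣ) (v : E r) (n : ℤ) : Fˣ :=
  if ip r v v = 4 then (if Even n then kr else k0) else k

/-- `𝐤_{a/2}`: `k` if `α` is short; `u_r` if `α` long, `n` even; `u₀` if `α` long, `n` odd. -/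
def khaf (u0 k ur : Fˣ) (v : E r) (n : ℤ) : Fˣ :=
  if ip r v v = 4 then (if Even n then ur else u0) else k

/-- The reflection `s_α(y) = y - α(y)·α^∨`. -/
def sRefl (v y : E r) : E r := y - ip r v y • coroot r v

/-- `s_{a,t}(x^y) = (g_y t)^{-n α^∨} · x^{s_α y}`. -/
def saTel (qh : Fˣ) (t : Fin r → Fˣ) (v : E r) (n : ℤ) (y : E r) : QA F r :=
  ((upowR F r (torusAct F r qh (gfun r y) t) (((-n : ℤ) : ℝ) • coroot r v) : Fˣ) : F) •
    X F r (sRefl r v y)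

/-- The twisted reflection operator `s_{a,t}`. -/
def SaOp (qh : Fˣ) (t : Fin r → Fˣ) (v : E r) (n : ℤ) : Module.End F (QA F r) :=
  mkOp F r (saTel F r qh t v n)

/-- The value `G_t^𝒪(a)(x^y)` for the affine root `a = (v, n)`. -/
def Gel (qh k0 u0 k kr ur : Fˣ) (t : Fin r → Fˣ) (v : E r) (n : ℤ) (y : E r) : QA F r :=
  (((kaf F r k0 k kr v n : Fˣ) : F) ^ chiE (ip r v y) *
      ((khaf F r u0 k ur v n : Fˣ) : F) ^ chiO (ip r v y)) • X F r y
    + ((((kaf F r k0 k kr v n : Fˣ) : F) - ((kaf F r k0 k kr v n : Fˣ) : F)⁻¹) •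
          geomS F r (((qsc F r qh v n)⁻¹ * (qsc F r qh v n)⁻¹ : Fˣ) : F)
            ((-2 : ℝ) • coroot r v) (-floorE (ip r v y) / 2)
        + (((khaf F r u0 k ur v n : Fˣ) : F) - ((khaf F r u0 k ur v n : Fˣ) : F)⁻¹) •
          ((((qsc F r qh v n)⁻¹ : Fˣ) : F) • X F r ((-1 : ℝ) • coroot r v) *
            geomS F r (((qsc F r qh v n)⁻¹ * (qsc F r qh v n)⁻¹ : Fˣ) : F)
              ((-2 : ℝ) • coroot r v) (-(floorO (ip r v y) + 1) / 2))) *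
      saTel F r qh t v n y

/-- The operator `G_t^𝒪(a)` for `a = (v, n)`. -/
def Gop (qh k0 u0 k kr ur : Fˣ) (t : Fin r → Fˣ) (v : E r) (n : ℤ) : Module.End F (QA F r) :=
  mkOp F r (Gel F r qh k0 u0 k kr ur t v n)

/-- The twisted action `g_t` of `g ∈ W` on `F[𝒪]`:
`g_t(x^y) = (g_{w₀ y} t)^{-λ} x^{w₀ y}` for `g = τ(λ) w₀`. -/
def Wtw (qh : Fˣ) (t : Fin r → Fˣ) (g : E r → E r) : Module.End F (QA F r) :=
  mkOp F r fun y =>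
    (((upowR F r (torusAct F r qh (gfun r (g y - g 0)) t) (g 0))⁻¹ : Fˣ) : F) •
      X F r (g y - g 0)

/-! ### The operators `D_j` -/

/-- The palindromic word `1, …, r-1, r, r-1, …, 1`. -/
def palin : List ℕ :=
  ((List.range (r - 1)).map (· + 1)) ++ [r] ++ ((List.range (r - 1)).map (· + 1)).reverse

/-- Multiplication by `x^{-ε₁}`. -/
def Mop : Module.End F (QA F r) := mkOp F r fun y => X F r ((-1 : ℝ) • epsV r 1) * X F r y

/-- `D₀ = (T₁^𝒪 ⋯ T_{r-1}^𝒪 T_r^𝒪 T_{r-1}^𝒪 ⋯ T₁^𝒪)⁻¹ ∘ M`. -/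
def D0op (qh : Fˣ) (k0 u0 k kr ur : F) (t : Fin r → Fˣ) : Module.End F (QA F r) :=
  ((palin r).map (TfullInv F r qh k0 u0 k kr ur t)).prod * Mop F r

/-- `D_j`: `D₀` for `j = 0` and `T_j^𝒪` for `1 ≤ j ≤ r`. -/
def Dop (qh : Fˣ) (k0 u0 k kr ur : F) (t : Fin r → Fˣ) (j : ℕ) : Module.End F (QA F r) :=
  if j = 0 then D0op F r qh k0 u0 k kr ur t else Tfull F r qh k0 u0 k kr ur t j

/-- Iterated application `D_{j₁}(D_{j₂}(⋯(D_{j_ℓ}(f))⋯))`. -/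
def applyD (qh : Fˣ) (k0 u0 k kr ur : F) (t : Fin r → Fˣ) (l : List ℕ) (f : QA F r) : QA F r :=
  l.foldr (fun j g => Dop F r qh k0 u0 k kr ur t j g) f

/-- The coefficients `k_{s_j}(y)`. -/
def ksj (k kr ur : Fˣ) (j : ℕ) (y : E r) : Fˣ :=
  if j = 0 then
    kr ^ (-etaE (2 * cd r y 1)) * ur ^ (-etaO (2 * cd r y 1)) *
      ∏ m : Fin r,
        (if 1 ≤ (m : ℕ) then k ^ (-eta (cd r y 1 - y m) - eta (cd r y 1 + y m)) else 1)
  else if j = r then kr ^ (-etaE (2 * cd r y r)) * ur ^ (-etaO (2 * cd r y r))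
  else k ^ (-eta (cd r y j - cd r y (j + 1)))

/-- `k_w(c) = ∏_m k_{s_{j_m}}(s_{j_{m+1}} ⋯ s_{j_ℓ} c)` for the word `w = s_{j₁} ⋯ s_{j_ℓ}`. -/
def kword (k kr ur : Fˣ) (l : List ℕ) (z : E r) : Fˣ :=
  (l.foldr (fun j p => (genF r j p.1, ksj F r k kr ur j p.1 * p.2)) (z, (1 : Fˣ))).2


/-- The defining properties of the twisted `W`-action `g ↦ g_t` on `F[𝒪]`. -/
def ActProp (F : Type*) [Field F] [CharZero F] (r : ℕ) (qh : Fˣ) (O : Set (E r))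
    (t : Fin r → Fˣ) (Θ : (E r → E r) → Module.End F (QA F r)) : Prop :=
  (∀ g g', IsWfun r g → IsWfun r g' → ∀ f ∈ FO F r O,
    Θ (fun y => g (g' y)) f = Θ g (Θ g' f)) ∧
  (∀ f ∈ FO F r O, Θ id f = f) ∧
  (∀ l : List ℕ, (∀ a ∈ l, 1 ≤ a ∧ a ≤ r) → ∀ y ∈ O,
    Θ (fun z => wordAct r l z) (X F r y) = X F r (wordAct r l y)) ∧
  (∀ lam : Fin r → ℤ, ∀ y ∈ O,
    Θ (fun z => z + zc r lam) (X F r y)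
      = (((upow F r (torusAct F r qh (gfun r y) t) lam)⁻¹ : Fˣ) : F) • X F r y) ∧
  (∀ g, IsWfun r g → ∀ p ∈ Lspan F r, ∀ f ∈ FO F r O,
    Θ g (p * f) = LWact F r qh g p * Θ g f)

/-! ### Explicit form of the affine Weyl group -/

/-- A general signed permutation followed by an integral translation. -/
def aff (π : Equiv.Perm (Fin r)) (σ : Fin r → ℤˣ) (lam : Fin r → ℤ) (y : E r) : E r :=
  fun m => (((σ m : ℤˣ) : ℤ) : ℝ) * y (π m) + (lam m : ℝ)

theorem aff_comp (π π' : Equiv.Perm (Fin r)) (σ σ' : Fin r → ℤˣ) (lam lam' : Fin r → ℤ)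
    (y : E r) :
    aff r π σ lam (aff r π' σ' lam' y) =
      aff r (π' * π) (fun m => σ m * σ' (π m)) (fun m => (σ m : ℤ) * lam' (π m) + lam m) y := by
  funext m
  simp only [aff, Equiv.Perm.mul_apply]
  push_cast
  ring

theorem aff_one (y : E r) : aff r 1 1 0 y = y := by
  funext m
  simp [aff]

theorem cd_fin (y : E r) (m : Fin r) : cd r y ((m : ℕ) + 1) = y m := by
  unfold cd
  simp [Fin.val_inj]

theorem tcU_fin (t : Fin r → Fˣ) (m : Fin r) : tcU F r t ((m : ℕ) + 1) = t m := by
  unfold tcU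
  simp [Fin.val_inj]

/-- The interchange generators. -/
theorem gen_swap (i : ℕ) (hi : i + 1 < r) (y : E r) :
    genF r (i + 1) y = aff r (Equiv.swap ⟨i, by omega⟩ ⟨i + 1, hi⟩) 1 0 y := by
  funext m
  have h1 : cd r y (i + 1) = y ⟨i, by omega⟩ := cd_fin r y ⟨i, by omega⟩
  have h2 : cd r y (i + 1 + 1) = y ⟨i + 1, hi⟩ := cd_fin r y ⟨i + 1, hi⟩
  have h3 : i + 1 ≠ r := by omega
  simp only [genF, sW, aff, h1, h2, h3, if_false, Nat.succ_ne_zero]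
  by_cases ha : m = ⟨i, by omega⟩
  · subst ha; simp
  · by_cases hb : m = ⟨i + 1, hi⟩
    · subst hb; simp
    · rw [Equiv.swap_apply_of_ne_of_ne ha hb]
      have ha' : (m : ℕ) ≠ i := fun h => ha (Fin.ext h)
      have hb' : (m : ℕ) ≠ i + 1 := fun h => hb (Fin.ext h)
      simp [ha', hb']

/-- The sign vector with `-1` at the positions in `s`. -/
def sgn (s : Finset (Fin r)) : Fin r → ℤˣ := fun m => if m ∈ s then -1 else 1

theorem gen_last (hr : 0 < r) (y : E r) :
    genF r r y = aff r 1 (sgn r {⟨r - 1, by omega⟩}) 0 y := by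
  funext m
  have h0 : r ≠ 0 := by omega
  simp only [genF, sW, aff, sgn, h0, if_false, if_true, Finset.mem_singleton, Fin.ext_iff]
  by_cases h : (m : ℕ) + 1 = r
  · have h' : (m : ℕ) = r - 1 := by omega
    simp [h']
    omega
  · have h' : ¬ (m : ℕ) = r - 1 := by omega
    simp [h, h']

theorem gen_zero (hr : 0 < r) (y : E r) :
    genF r 0 y = aff r 1 (sgn r {⟨0, hr⟩}) (Pi.single ⟨0, hr⟩ 1) y := by
  funext m
  simp only [genF, aff, sgn, if_true, Finset.mem_singleton]
  by_cases h : m = ⟨0, hr⟩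
  · subst h; simp; ring
  · have h' : (m : ℕ) ≠ 0 := fun e => h (Fin.ext e)
    simp [h, h']

theorem gen_aff0 (j : ℕ) (h1 : 1 ≤ j) (h2 : j ≤ r) :
    ∃ π σ, ∀ y, genF r j y = aff r π σ 0 y := by
  rcases Nat.lt_or_ge j r with h | h
  · obtain ⟨i, rfl⟩ : ∃ i, j = i + 1 := ⟨j - 1, by omega⟩
    exact ⟨_, _, gen_swap r i h⟩
  · obtain rfl : j = r := by omega
    exact ⟨_, _, gen_last j (by omega)⟩

theorem gen_aff (hr : 0 < r) (j : ℕ) (h2 : j ≤ r) :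
    ∃ π σ lam, ∀ y, genF r j y = aff r π σ lam y := by
  rcases Nat.eq_zero_or_pos j with rfl | h
  · exact ⟨_, _, _, gen_zero r hr⟩
  · obtain ⟨π, σ, h⟩ := gen_aff0 r j h h2
    exact ⟨π, σ, 0, h⟩

theorem gen_invol (hr : 0 < r) (j : ℕ) (h2 : j ≤ r) (y : E r) :
    genF r j (genF r j y) = y := by
  have key : ∀ (s : Finset (Fin r)) (m : Fin r), sgn r s m * sgn r s m = 1 := by
    intro s m; unfold sgn; split_ifs <;> simp
  rcases Nat.eq_zero_or_pos j with rfl | h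
  · funext m
    simp only [genF, if_true]
    split_ifs <;> ring
  rcases Nat.lt_or_ge j r with h | h
  · obtain ⟨i, rfl⟩ : ∃ i, j = i + 1 := ⟨j - 1, by omega⟩
    rw [gen_swap r i h, gen_swap r i h, aff_comp]
    funext m
    simp [aff]
  · obtain rfl : j = r := by omega
    rw [gen_last j hr, gen_last j hr, aff_comp]
    funext m
    simp only [aff, Equiv.Perm.one_apply, key, mul_one]
    simp

theorem word_append (l l' : List ℕ) (y : E r) :
    wordAct r (l ++ l') y = wordAct r l (wordAct r l' y) := by
  simp [wordAct, List.foldr_append]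

theorem word_aff (hr : 0 < r) (l : List ℕ) (hl : ∀ a ∈ l, a ≤ r) :
    ∃ π σ lam, ∀ y, wordAct r l y = aff r π σ lam y := by
  induction l with
  | nil => exact ⟨1, 1, 0, fun y => (aff_one r y).symm⟩
  | cons a l ih =>
    obtain ⟨π, σ, lam, h⟩ := ih fun b hb => hl b (List.mem_cons_of_mem _ hb)
    obtain ⟨π', σ', lam', h'⟩ := gen_aff r hr a (hl a List.mem_cons_self)
    refine ⟨π * π', fun m => σ' m * σ (π' m),
      fun m => (σ' m : ℤ) * lam (π' m) + lam' m, fun y => ?_⟩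
    rw [← aff_comp, ← h, ← h']
    rfl

theorem word_aff0 (l : List ℕ) (hl : ∀ a ∈ l, 1 ≤ a ∧ a ≤ r) :
    ∃ π σ, ∀ y, wordAct r l y = aff r π σ 0 y := by
  induction l with
  | nil => exact ⟨1, 1, fun y => (aff_one r y).symm⟩
  | cons a l ih =>
    obtain ⟨π, σ, h⟩ := ih fun b hb => hl b (List.mem_cons_of_mem _ hb)
    obtain ⟨h1, h2⟩ := hl a List.mem_cons_self
    obtain ⟨π', σ', h'⟩ := gen_aff0 r a h1 h2
    refine ⟨π * π', fun m => σ' m * σ (π' m), fun y => ?_⟩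
    have := aff_comp r π' π σ' σ 0 0 y
    rw [← h, ← h'] at this
    refine Eq.trans this ?_
    congr 1
    funext m
    simp

theorem word_reverse (hr : 0 < r) (l : List ℕ) (hl : ∀ a ∈ l, a ≤ r) (y : E r) :
    wordAct r l (wordAct r l.reverse y) = y := by
  induction l generalizing y with
  | nil => rfl
  | cons a l ih =>
    rw [List.reverse_cons, word_append]
    have h1 := ih (fun b hb => hl b (List.mem_cons_of_mem _ hb)) (genF r a y)
    have h2 : wordAct r [a] y = genF r a y := rfl
    have h3 : ∀ z, wordAct r (a :: l) z = genF r a (wordAct r l z) := fun z => rfl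
    rw [h3, h2, h1, gen_invol r hr a (hl a List.mem_cons_self)]

/-- Realisation by words in the finite generators. -/
def W0word (g : E r → E r) : Prop :=
  ∃ l : List ℕ, (∀ a ∈ l, 1 ≤ a ∧ a ≤ r) ∧ ∀ y, wordAct r l y = g y

theorem W0word.comp {g g' : E r → E r} (h : W0word r g) (h' : W0word r g') :
    W0word r (fun y => g (g' y)) := by
  obtain ⟨l, hl, e⟩ := h
  obtain ⟨l', hl', e'⟩ := h'
  refine ⟨l ++ l', ?_, fun y => by rw [word_append, e', e]⟩
  intro a ha
  rcases List.mem_append.1 ha with h | h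
  · exact hl a h
  · exact hl' a h

theorem W0word_perm (π : Equiv.Perm (Fin r)) : W0word r (aff r π 1 0) := by
  rcases r with _ | n
  · exact ⟨[], by simp, fun y => funext fun m => m.elim0⟩
  have hπ : π ∈ Submonoid.closure (Set.range fun i : Fin n => Equiv.swap i.castSucc i.succ) := by
    rw [Equiv.Perm.mclosure_swap_castSucc_succ]; trivial
  induction hπ using Submonoid.closure_induction with
  | mem x hx =>
    obtain ⟨i, rfl⟩ := hx
    refine ⟨[(i : ℕ) + 1], ?_, fun y => ?_⟩
    · intro a ha
      have := i.2
      simp at ha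
      omega
    · exact gen_swap (n + 1) i (by omega) y
  | one => exact ⟨[], by simp, fun y => (aff_one _ y).symm⟩
  | mul x y _ _ hx hy =>
    have := W0word.comp (n + 1) hy hx
    convert this using 2 with z
    rw [aff_comp]
    funext m
    simp [aff]

theorem W0word_neg1 (k : Fin r) : W0word r (aff r 1 (sgn r {k}) 0) := by
  have hr : 0 < r := by have := k.2; omega
  have hs : W0word r (aff r 1 (sgn r {⟨r - 1, by omega⟩}) 0) := by
    refine ⟨[r], ?_, fun y => gen_last r hr y⟩
    intro a ha
    simp at ha
    omega
  have hp := W0word_perm r (Equiv.swap k ⟨r - 1, by omega⟩)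
  have := (hp.comp r hs).comp r hp
  convert this using 2 with y
  rw [aff_comp, aff_comp]
  funext m
  simp only [aff, sgn, Finset.mem_singleton]
  simp [Equiv.swap_apply_eq_iff]

theorem sgn_surj (σ : Fin r → ℤˣ) : ∃ s, σ = sgn r s := by
  refine ⟨Finset.univ.filter fun m => σ m = -1, ?_⟩
  funext m
  simp only [sgn, Finset.mem_filter, Finset.mem_univ, true_and]
  split_ifs with h
  · exact h
  · exact (Int.units_eq_one_or (σ m)).resolve_right h

theorem W0word_neg (s : Finset (Fin r)) : W0word r (aff r 1 (sgn r s) 0) := by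
  induction s using Finset.induction_on with
  | empty => exact ⟨[], by simp, fun y => funext fun m => by simp [aff, sgn, wordAct]⟩
  | insert k s hk ih =>
    have := (W0word_neg1 r k).comp r ih
    convert this using 2 with y
    rw [aff_comp]
    funext m
    simp only [aff, sgn, Finset.mem_insert, Finset.mem_singleton]
    by_cases h : m = k
    · subst h; simp [hk]
    · by_cases h2 : m ∈ s <;> simp [h, h2]

theorem W0word_aff (π : Equiv.Perm (Fin r)) (σ : Fin r → ℤˣ) : W0word r (aff r π σ 0) := by
  obtain ⟨s, rfl⟩ := sgn_surj r σ
  have := (W0word_neg r s).comp r (W0word_perm r π)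
  convert this using 2 with y
  rw [aff_comp]
  funext m
  simp [aff]

theorem W0word.isW {g : E r → E r} (h : W0word r g) : IsWfun r g := by
  obtain ⟨l, hl, e⟩ := h
  exact ⟨l, fun a ha => (hl a ha).2, funext fun y => (e y).symm⟩

theorem IsW_comp {g g' : E r → E r} (h : IsWfun r g) (h' : IsWfun r g') :
    IsWfun r (fun y => g (g' y)) := by
  obtain ⟨l, hl, rfl⟩ := h
  obtain ⟨l', hl', rfl⟩ := h'
  refine ⟨l ++ l', ?_, funext fun y => by rw [word_append]⟩
  intro a ha
  rcases List.mem_append.1 ha with h | h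
  · exact hl a h
  · exact hl' a h

/-- The lattice of translations in `W`. -/
def transW : AddSubgroup (Fin r → ℤ) where
  carrier := {lam | IsWfun r (aff r 1 1 lam)}
  zero_mem' := ⟨[], by simp, funext fun y => aff_one r y⟩
  add_mem' := by
    intro a b ha hb
    have := IsW_comp r ha hb
    show IsWfun r (aff r 1 1 (a + b))
    convert this using 1
    funext y m
    simp [aff]
    ring
  neg_mem' := by
    intro a ha
    have hn := (W0word_aff r 1 (fun _ => -1)).isW
    have := IsW_comp r (IsW_comp r hn ha) hn
    show IsWfun r (aff r 1 1 (-a))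
    convert this using 1
    funext y m
    simp [aff]
    ring

theorem transW_single (k : Fin r) : Pi.single k 1 ∈ transW r := by
  have hr : 0 < r := by have := k.2; omega
  have h0 : IsWfun r (aff r 1 (sgn r {⟨0, hr⟩}) (Pi.single ⟨0, hr⟩ 1)) := by
    refine ⟨[0], by simp, funext fun y => (gen_zero r hr y).symm⟩
  have hn := (W0word_aff r 1 (sgn r {⟨0, hr⟩})).isW
  have hp := (W0word_perm r (Equiv.swap k ⟨0, hr⟩)).isW
  have := IsW_comp r (IsW_comp r hp (IsW_comp r h0 hn)) hp
  show IsWfun r (aff r 1 1 _)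
  convert this using 1
  funext y m
  simp only [aff_comp]
  simp only [aff, sgn, Finset.mem_singleton]
  by_cases h : m = k
  · subst h; simp
  · have h' : (Equiv.swap k ⟨0, hr⟩) m ≠ ⟨0, hr⟩ := by
      rw [Ne, Equiv.swap_apply_eq_iff]; simpa using h
    simp [h, h']

theorem transW_all (lam : Fin r → ℤ) : IsWfun r (aff r 1 1 lam) := by
  have : lam ∈ transW r := by
    rw [← Finset.univ_sum_single lam]
    refine AddSubgroup.sum_mem _ fun k _ => ?_
    have := AddSubgroup.zsmul_mem _ (transW_single r k) (lam k)
    rwa [← Pi.single_smul, smul_eq_mul, mul_one] at this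
  exact this

theorem IsW_aff (π : Equiv.Perm (Fin r)) (σ : Fin r → ℤˣ) (lam : Fin r → ℤ) :
    IsWfun r (aff r π σ lam) := by
  have := IsW_comp r (transW_all r lam) (W0word_aff r π σ).isW
  convert this using 1
  funext y m
  simp [aff]

theorem IsW_exists (hr : 0 < r) {g : E r → E r} (h : IsWfun r g) :
    ∃ π σ lam, g = aff r π σ lam := by
  obtain ⟨l, hl, rfl⟩ := h
  obtain ⟨π, σ, lam, h⟩ := word_aff r hr l hl
  exact ⟨π, σ, lam, funext h⟩

/-! ### The fundamental alcove -/

theorem exists_alcove (y : E r) : ∃ π σ lam, aff r π σ lam y ∈ CplusCl r := by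
  have hs : ∀ m, ∃ s : ℤˣ, (((s : ℤˣ) : ℤ) : ℝ) * (y m - round (y m)) = |y m - round (y m)| := by
    intro m
    rcases abs_cases (y m - round (y m)) with ⟨h, _⟩ | ⟨h, _⟩
    · exact ⟨1, by simp [h]⟩
    · exact ⟨-1, by simp [h]⟩
  choose s hs using hs
  let a : Fin r → ℝ := fun m => |y m - round (y m)|
  let π := Tuple.sort (fun m => - a m)
  have hmono := Tuple.monotone_sort (fun m => - a m)
  have e : aff r π (fun m => s (π m)) (fun m => -((s (π m) : ℤ) * round (y (π m)))) y
      = fun m => a (π m) := by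
    funext m
    have := hs (π m)
    simp only [aff, a]
    rw [← this]
    push_cast
    ring
  refine ⟨π, fun m => s (π m), fun m => -((s (π m) : ℤ) * round (y (π m))), ?_⟩
  rw [e]
  refine ⟨fun i j hij => ?_, fun m => ⟨abs_nonneg _, ?_⟩⟩
  · have := hmono hij
    simp only [Function.comp] at this
    linarith
  · exact abs_sub_round _

/-- An integer strictly between `-1` and `1`. -/
theorem int_small {n : ℤ} (h1 : (-1 : ℝ) < n) (h2 : (n : ℝ) < 1) : n = 0 := by
  have h1' : (-1 : ℤ) < n := by exact_mod_cast h1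
  have h2' : n < (1 : ℤ) := by exact_mod_cast h2
  omega

theorem alcove_val {a b : ℝ} (ha : 0 ≤ a ∧ a ≤ 1 / 2) (hb : 0 ≤ b ∧ b ≤ 1 / 2) (s : ℤˣ) (n : ℤ)
    (h : b = ((s : ℤ) : ℝ) * a + n) :
    (s = 1 ∧ a = b ∧ n = 0) ∨ (s = -1 ∧ a = b ∧ a = 0 ∧ n = 0) ∨
      (s = -1 ∧ a = b ∧ a = 1 / 2 ∧ n = 1) := by
  rcases Int.units_eq_one_or s with rfl | rfl
  · left
    simp at h
    have : n = 0 := int_small (by linarith) (by linarith)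
    subst this
    simp at h
    exact ⟨rfl, h.symm, rfl⟩
  · right
    simp at h
    have h1 : (-1 : ℤ) < n := by
      have : (-1 : ℝ) < n := by linarith
      exact_mod_cast this
    have h2 : n < (2 : ℤ) := by
      have : (n : ℝ) < 2 := by linarith
      exact_mod_cast this
    have : n = 0 ∨ n = 1 := by omega
    rcases this with rfl | rfl
    · left
      simp at h
      refine ⟨rfl, ?_, ?_, rfl⟩ <;> linarith
    · right
      simp at h
      refine ⟨rfl, ?_, ?_, rfl⟩ <;> linarith

theorem alcove_unique (c c' : E r) (hc : c ∈ CplusCl r) (hc' : c' ∈ CplusCl r)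
    (π : Equiv.Perm (Fin r)) (σ : Fin r → ℤˣ) (lam : Fin r → ℤ) (h : c' = aff r π σ lam c) :
    c' = c := by
  have e : c' = c ∘ π := by
    funext m
    have := alcove_val (hc.2 (π m)) (hc'.2 m) (σ m) (lam m) (congrFun h m)
    simp only [Function.comp]
    rcases this with h | h | h
    · exact h.2.1.symm
    · exact h.2.1.symm
    · exact h.2.1.symm
  have h1 : Monotone ((fun m => - c m) ∘ π) := by
    intro i j hij
    have := hc'.1 i j hij
    rw [e] at this
    simp only [Function.comp] at this ⊢
    linarith
  have h2 : Monotone ((fun m => - c m) ∘ (1 : Equiv.Perm (Fin r))) := by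
    intro i j hij
    have := hc.1 i j hij
    simp only [Function.comp, Equiv.Perm.one_apply]
    linarith
  have h3 := Tuple.unique_monotone h1 h2
  rw [e]
  funext m
  have := congrFun h3 m
  simp only [Function.comp, Equiv.Perm.one_apply] at this ⊢
  linarith

theorem aff_inv (π : Equiv.Perm (Fin r)) (σ : Fin r → ℤˣ) (lam : Fin r → ℤ) :
    ∃ π' σ' lam', ∀ y, aff r π' σ' lam' (aff r π σ lam y) = y := by
  refine ⟨π.symm, fun m => σ (π.symm m), fun m => -((σ (π.symm m) : ℤ) * lam (π.symm m)),
    fun y => ?_⟩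
  funext m
  simp only [aff, Equiv.apply_symm_apply]
  rcases Int.units_eq_one_or (σ (π.symm m)) with h | h <;> simp [h]

theorem mem_orbit_iff (hr : 0 < r) (y z : E r) :
    z ∈ orbit r y ↔ ∃ π σ lam, z = aff r π σ lam y := by
  constructor
  · rintro ⟨l, hl, rfl⟩
    obtain ⟨π, σ, lam, h⟩ := word_aff r hr l hl
    exact ⟨π, σ, lam, h y⟩
  · rintro ⟨π, σ, lam, rfl⟩
    obtain ⟨l, hl, e⟩ := IsW_aff r π σ lam
    exact ⟨l, hl, (congrFun e y).symm⟩

theorem orbit_aff (hr : 0 < r) {O : Set (E r)} (hO : IsOrbit r O) {y : E r} (hy : y ∈ O)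
    (π : Equiv.Perm (Fin r)) (σ : Fin r → ℤˣ) (lam : Fin r → ℤ) : aff r π σ lam y ∈ O := by
  obtain ⟨y0, rfl⟩ := hO
  rw [mem_orbit_iff r hr] at hy ⊢
  obtain ⟨π', σ', lam', rfl⟩ := hy
  rw [aff_comp]
  exact ⟨_, _, _, rfl⟩

theorem orbit_rel (hr : 0 < r) {O : Set (E r)} (hO : IsOrbit r O) {y z : E r} (hy : y ∈ O)
    (hz : z ∈ O) : ∃ π σ lam, z = aff r π σ lam y := by
  obtain ⟨y0, rfl⟩ := hO
  rw [mem_orbit_iff r hr] at hy hz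
  obtain ⟨π', σ', lam', rfl⟩ := hy
  obtain ⟨π, σ, lam, rfl⟩ := hz
  obtain ⟨p, s, l, h⟩ := aff_inv r π' σ' lam'
  have : aff r π σ lam y0 = aff r π σ lam (aff r p s l (aff r π' σ' lam' y0)) := by rw [h]
  rw [this, aff_comp r π p]
  exact ⟨_, _, _, rfl⟩

theorem cpt_spec (hr : 0 < r) {O : Set (E r)} (hO : IsOrbit r O) :
    cpt r O ∈ O ∧ cpt r O ∈ CplusCl r := by
  have h : ∃ c, c ∈ O ∧ c ∈ CplusCl r := by
    obtain ⟨y0, rfl⟩ := hO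
    obtain ⟨π, σ, lam, h⟩ := exists_alcove r y0
    exact ⟨_, (mem_orbit_iff r hr _ _).2 ⟨π, σ, lam, rfl⟩, h⟩
  unfold cpt
  rw [dif_pos h]
  exact h.choose_spec

theorem gW_spec (y : E r) : (∀ a ∈ gW r y, a ≤ r) ∧ wordAct r (gW r y).reverse y ∈ CplusCl r := by
  have h0 : ∃ n : ℕ, ∃ l : List ℕ, l.length = n ∧ (∀ a ∈ l, a ≤ r) ∧
      wordAct r l.reverse y ∈ CplusCl r := by
    obtain ⟨π, σ, lam, h⟩ := exists_alcove r y
    obtain ⟨l, hl, e⟩ := IsW_aff r π σ lam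
    refine ⟨_, l.reverse, rfl, fun a ha => hl a (List.mem_reverse.1 ha), ?_⟩
    rw [List.reverse_reverse]
    rw [e] at h
    exact h
  have h : ∃ l : List ℕ, (∀ a ∈ l, a ≤ r) ∧ wordAct r l.reverse y ∈ CplusCl r ∧
      ∀ l' : List ℕ, (∀ a ∈ l', a ≤ r) → wordAct r l'.reverse y ∈ CplusCl r →
        l.length ≤ l'.length := by
    obtain ⟨l, h1, h2, h3⟩ := Nat.find_spec h0
    refine ⟨l, h2, h3, fun l' h4 h5 => ?_⟩
    rw [h1]
    exact Nat.find_min' h0 ⟨l', rfl, h4, h5⟩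
  unfold gW
  rw [dif_pos h]
  exact ⟨h.choose_spec.1, h.choose_spec.2.1⟩

theorem gfun_spec (hr : 0 < r) {O : Set (E r)} (hO : IsOrbit r O) {y : E r} (hy : y ∈ O) :
    ∃ π σ lam, gfun r y = aff r π σ lam ∧ y = aff r π σ lam (cpt r O) := by
  obtain ⟨h1, h2⟩ := gW_spec r y
  obtain ⟨π, σ, lam, h⟩ := word_aff r hr (gW r y) h1
  refine ⟨π, σ, lam, funext h, ?_⟩
  have h3 := word_reverse r hr (gW r y) h1 y
  obtain ⟨c1, c2⟩ := cpt_spec r hr hO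
  obtain ⟨p, s, l, e⟩ := word_aff r hr (gW r y).reverse
    fun a ha => h1 a (List.mem_reverse.1 ha)
  have h4 : wordAct r (gW r y).reverse y ∈ O := by
    rw [e]
    exact orbit_aff r hr hO hy _ _ _
  obtain ⟨p', s', l', e'⟩ := orbit_rel r hr hO c1 h4
  have h5 := alcove_unique r _ _ c2 h2 _ _ _ e'
  rw [h5, h] at h3
  exact h3.symm

/-! ### The torus point attached to a point of the orbit -/

theorem TO_eq_aux {c : E r} (hc : c ∈ CplusCl r) {qh : Fˣ} {t : Fin r → Fˣ}
    (ht : ∀ j : ℕ, j ≤ r → alphaF r j c = 0 → tpowCo F r qh t j = 1)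
    (j : Fin r) (n : ℕ) (hjn : (j : ℕ) ≤ n) :
    ∀ hn : n < r, c ⟨n, hn⟩ = c j → t ⟨n, hn⟩ = t j := by
  induction n, hjn using Nat.le_induction with
  | base => intro hn _; rfl
  | succ n hjn ih =>
    intro hn h
    have hn' : n < r := by omega
    have h1 : c ⟨n + 1, hn⟩ ≤ c ⟨n, hn'⟩ := hc.1 _ _ (by simp [Fin.le_def])
    have h2 : c ⟨n, hn'⟩ ≤ c j := hc.1 _ _ (by simpa [Fin.le_def] using hjn)
    have h3 : c ⟨n, hn'⟩ = c j := by linarith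
    rw [← ih hn' h3]
    have hne : n + 1 ≠ r := by omega
    have e1 : cd r c (n + 1) = c ⟨n, hn'⟩ := cd_fin r c ⟨n, hn'⟩
    have e2 : cd r c (n + 1 + 1) = c ⟨n + 1, hn⟩ := cd_fin r c ⟨n + 1, hn⟩
    have e3 : tcU F r t (n + 1) = t ⟨n, hn'⟩ := tcU_fin F r t ⟨n, hn'⟩
    have e4 : tcU F r t (n + 1 + 1) = t ⟨n + 1, hn⟩ := tcU_fin F r t ⟨n + 1, hn⟩
    have h4 := ht (n + 1) (by omega) (by simp [alphaF, hne, e1, e2, h, h3])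
    simp only [tpowCo, hne, if_false, Nat.succ_ne_zero, e3, e4] at h4
    exact (mul_inv_eq_one.1 h4).symm

theorem TO_eq {c : E r} (hc : c ∈ CplusCl r) {qh : Fˣ} {t : Fin r → Fˣ}
    (ht : ∀ j : ℕ, j ≤ r → alphaF r j c = 0 → tpowCo F r qh t j = 1)
    (j k : Fin r) (h : c j = c k) : t j = t k := by
  rcases le_total (j : ℕ) (k : ℕ) with hjk | hjk
  · exact (TO_eq_aux F r hc ht j k hjk k.2 h.symm).symm
  · exact TO_eq_aux F r hc ht k j hjk j.2 h

theorem TO_zero (hr : 0 < r) {c : E r} (hc : c ∈ CplusCl r) {qh : Fˣ} {t : Fin r → Fˣ}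
    (ht : ∀ j : ℕ, j ≤ r → alphaF r j c = 0 → tpowCo F r qh t j = 1)
    (j : Fin r) (h : c j = 0) : t j = 1 := by
  have hl : r - 1 < r := by omega
  have h1 : c ⟨r - 1, hl⟩ ≤ c j := hc.1 _ _ (by simp [Fin.le_def]; omega)
  have h2 := (hc.2 ⟨r - 1, hl⟩).1
  have h3 : c ⟨r - 1, hl⟩ = 0 := by linarith
  rw [TO_eq F r hc ht j ⟨r - 1, hl⟩ (by rw [h, h3])]
  have e1 := cd_fin r c ⟨r - 1, hl⟩
  have e2 := tcU_fin F r t ⟨r - 1, hl⟩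
  have e3 : r - 1 + 1 = r := by omega
  simp only [e3] at e1 e2
  have hne : r ≠ 0 := by omega
  have h4 := ht r le_rfl (by simp [alphaF, hne, e1, h3])
  simpa only [tpowCo, hne, if_false, if_true, e2] using h4

theorem TO_half (hr : 0 < r) {c : E r} (hc : c ∈ CplusCl r) {qh : Fˣ} {t : Fin r → Fˣ}
    (ht : ∀ j : ℕ, j ≤ r → alphaF r j c = 0 → tpowCo F r qh t j = 1)
    (j : Fin r) (h : c j = 1 / 2) : t j = qh := by
  have h1 : c j ≤ c ⟨0, hr⟩ := hc.1 _ _ (by simp [Fin.le_def])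
  have h2 := (hc.2 ⟨0, hr⟩).2
  have h3 : c ⟨0, hr⟩ = 1 / 2 := by linarith
  rw [TO_eq F r hc ht j ⟨0, hr⟩ (by rw [h, h3])]
  have e1 := cd_fin r c ⟨0, hr⟩
  have e2 := tcU_fin F r t ⟨0, hr⟩
  simp only [zero_add] at e1 e2
  have h4 := ht 0 (by omega) (by simp [alphaF, e1, h3])
  simp only [tpowCo, if_true, e2] at h4
  exact (mul_inv_eq_one.1 h4).symm

theorem TO_key (hr : 0 < r) {c : E r} (hc : c ∈ CplusCl r) {qh : Fˣ} {t : Fin r → Fˣ}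
    (ht : ∀ j : ℕ, j ≤ r → alphaF r j c = 0 → tpowCo F r qh t j = 1)
    (j k : Fin r) (s s' : ℤˣ) (n n' : ℤ)
    (h : ((s : ℤ) : ℝ) * c j + n = ((s' : ℤ) : ℝ) * c k + n') :
    (qh * qh) ^ n * t j ^ (s : ℤ) = (qh * qh) ^ n' * t k ^ (s' : ℤ) := by
  have h' : c k = (((s' * s : ℤˣ) : ℤ) : ℝ) * c j + (((s' : ℤ) * (n - n') : ℤ) : ℝ) := by
    rcases Int.units_eq_one_or s' with rfl | rfl <;>
      rcases Int.units_eq_one_or s with rfl | rfl <;>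
      · simp at h ⊢
        linarith
  rcases alcove_val (hc.2 j) (hc.2 k) _ _ h' with ⟨h1, h2, h3⟩ | ⟨h1, h2, h3, h4⟩ | ⟨h1, h2, h3, h4⟩
  · rw [TO_eq F r hc ht j k h2]
    have : n = n' := by
      rcases Int.units_eq_one_or s' with rfl | rfl <;> simp at h3 <;> omega
    have hs : s = s' := by
      rcases Int.units_eq_one_or s' with rfl | rfl <;>
        rcases Int.units_eq_one_or s with rfl | rfl <;> simp at h1 ⊢
    rw [this, hs]
  · rw [← TO_eq F r hc ht j k h2, TO_zero F r hr hc ht j h3]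
    have : n = n' := by
      rcases Int.units_eq_one_or s' with rfl | rfl <;> simp at h4 <;> omega
    simp [this]
  · rw [← TO_eq F r hc ht j k h2, TO_half F r hr hc ht j h3]
    rcases Int.units_eq_one_or s' with rfl | rfl <;>
      rcases Int.units_eq_one_or s with rfl | rfl <;> simp at h1 h4 ⊢
    · obtain rfl : n = n' + 1 := by omega
      rw [zpow_add_one]
      group
    · obtain rfl : n' = n + 1 := by omega
      rw [zpow_add_one]
      group

theorem torusAct_aff (qh : Fˣ) (t : Fin r → Fˣ) (π : Equiv.Perm (Fin r)) (σ : Fin r → ℤˣ)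
    (lam : Fin r → ℤ) (m : Fin r) :
    torusAct F r qh (aff r π σ lam) t m = (qh * qh) ^ lam m * t (π m) ^ ((σ m : ℤˣ) : ℤ) := by
  have h0 : ⌊aff r π σ lam 0 m⌋ = lam m := by simp [aff]
  have h1 : ∀ j, ⌊(aff r π σ lam (eV r j) - aff r π σ lam 0) m⌋
      = if π m = j then ((σ m : ℤˣ) : ℤ) else 0 := by
    intro j
    by_cases h : π m = j <;> simp [aff, eV, h]
  unfold torusAct
  simp only [h0, h1]
  congr 1
  rw [Finset.prod_eq_single (π m)]
  · simp
  · intro b _ hb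
    simp [hb.symm]
  · simp

/-- The torus point `g_y t`. -/
def Tor (qh : Fˣ) (t : Fin r → Fˣ) (y : E r) : Fin r → Fˣ := torusAct F r qh (gfun r y) t

theorem Tor_transfer (hr : 0 < r) {O : Set (E r)} (hO : IsOrbit r O) {qh : Fˣ} {t : Fin r → Fˣ}
    (ht : t ∈ TOset F r qh O) {y y' : E r} (hy : y ∈ O) (hy' : y' ∈ O) (m m' : Fin r)
    (s : ℤˣ) (n : ℤ) (h : y' m' = ((s : ℤ) : ℝ) * y m + n) :
    Tor F r qh t y' m' = (qh * qh) ^ n * Tor F r qh t y m ^ (s : ℤ) := by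
  obtain ⟨π, σ, lam, h1, h2⟩ := gfun_spec r hr hO hy
  obtain ⟨π', σ', lam', h1', h2'⟩ := gfun_spec r hr hO hy'
  unfold Tor
  rw [h1, h1', torusAct_aff, torusAct_aff]
  have e := congrFun h2 m
  have e' := congrFun h2' m'
  simp only [aff] at e e'
  rw [e, e'] at h
  rw [TO_key F r hr (cpt_spec r hr hO).2 ht (π' m') (π m) (σ' m') (s * σ m) (lam' m')
    ((s : ℤ) * lam m + n) (by rw [h]; push_cast; ring)]
  generalize qh * qh = q
  rw [mul_zpow, ← zpow_mul, ← zpow_mul, zpow_add]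
  push_cast
  rw [mul_comm (lam m), mul_comm (s : ℤ) (σ m : ℤ), ← mul_assoc]
  congr 1
  rw [mul_comm]

/-! ### The operators -/

theorem mkOp_X (Ψ : E r → QA F r) (y : E r) : mkOp F r Ψ (X F r y) = Ψ y := by
  simp [mkOp, X]

theorem X_mul (y z : E r) : X F r y * X F r z = X F r (y + z) := by
  simp [X, AddMonoidAlgebra.single_mul_single]

theorem aff_sub (π : Equiv.Perm (Fin r)) (σ : Fin r → ℤˣ) (lam : Fin r → ℤ) (y : E r) :
    aff r π σ lam y - aff r π σ lam 0 = aff r π σ 0 y := by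
  funext m
  simp [aff]

theorem aff_at_zero (π : Equiv.Perm (Fin r)) (σ : Fin r → ℤˣ) (lam : Fin r → ℤ) :
    aff r π σ lam 0 = zc r lam := by
  funext m
  simp [aff, zc]

theorem upowR_zc (u : Fin r → Fˣ) (lam : Fin r → ℤ) : upowR F r u (zc r lam) = upow F r u lam := by
  simp [upowR, upow, zc]

theorem Wtw_X (qh : Fˣ) (t : Fin r → Fˣ) (π : Equiv.Perm (Fin r)) (σ : Fin r → ℤˣ)
    (lam : Fin r → ℤ) (y : E r) :
    Wtw F r qh t (aff r π σ lam) (X F r y) =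
      (((upow F r (Tor F r qh t (aff r π σ 0 y)) lam)⁻¹ : Fˣ) : F) • X F r (aff r π σ 0 y) := by
  unfold Wtw
  rw [mkOp_X, aff_sub, aff_at_zero, upowR_zc]
  rfl

theorem LWact_X (qh : Fˣ) (π : Equiv.Perm (Fin r)) (σ : Fin r → ℤˣ)
    (lam mu : Fin r → ℤ) :
    LWact F r qh (aff r π σ lam) (X F r (zc r mu)) =
      (((qh * qh) ^ (-∑ m, ((σ m : ℤ) * mu (π m)) * lam m) : Fˣ) : F) •
        X F r (aff r π σ 0 (zc r mu)) := by
  have : ip r (aff r π σ 0 (zc r mu)) (zc r lam)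
      = ((∑ m, ((σ m : ℤ) * mu (π m)) * lam m : ℤ) : ℝ) := by
    simp [ip, aff, zc]
  unfold LWact
  rw [mkOp_X, aff_sub, aff_at_zero, this, Int.floor_intCast]

theorem FO_ext {O : Set (E r)} (A B : Module.End F (QA F r))
    (h : ∀ y ∈ O, A (X F r y) = B (X F r y)) : ∀ f ∈ FO F r O, A f = B f := by
  intro f hf
  refine LinearMap.eqOn_span (f := A) (g := B) ?_ hf
  rintro _ ⟨y, hy, rfl⟩
  exact h y hy

theorem upow_comp (hr : 0 < r) {O : Set (E r)} (hO : IsOrbit r O) {qh : Fˣ} {t : Fin r → Fˣ}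
    (ht : t ∈ TOset F r qh O) {y : E r} (hy : y ∈ O) (π : Equiv.Perm (Fin r))
    (σ : Fin r → ℤˣ) (lam : Fin r → ℤ) :
    upow F r (Tor F r qh t (aff r π σ 0 y)) (fun m => (σ m : ℤ) * lam (π m)) =
      upow F r (Tor F r qh t y) lam := by
  unfold upow
  rw [← Equiv.prod_comp π (fun m => Tor F r qh t y m ^ lam m)]
  refine Finset.prod_congr rfl fun m _ => ?_
  rw [Tor_transfer F r hr hO ht hy (orbit_aff r hr hO hy π σ 0) (π m) m (σ m) 0 (by simp [aff])]
  rw [zpow_zero, one_mul, ← zpow_mul, ← mul_assoc]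
  have : ((σ m : ℤˣ) : ℤ) * ((σ m : ℤˣ) : ℤ) = 1 := by
    rcases Int.units_eq_one_or (σ m) with h | h <;> simp [h]
  rw [this, one_mul]

theorem upow_add (u : Fin r → Fˣ) (a b : Fin r → ℤ) :
    upow F r u (a + b) = upow F r u a * upow F r u b := by
  simp [upow, zpow_add, Finset.prod_mul_distrib]

theorem upow_shift (hr : 0 < r) {O : Set (E r)} (hO : IsOrbit r O) {qh : Fˣ} {t : Fin r → Fˣ}
    (ht : t ∈ TOset F r qh O) {y : E r} (hy : y ∈ O) (mu lam : Fin r → ℤ)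
    (hy' : y + zc r mu ∈ O) :
    upow F r (Tor F r qh t (y + zc r mu)) lam =
      (qh * qh) ^ (∑ m, mu m * lam m) * upow F r (Tor F r qh t y) lam := by
  unfold upow
  have : (qh * qh) ^ (∑ m, mu m * lam m) = ∏ m, (qh * qh) ^ (mu m * lam m) := by
    generalize qh * qh = q
    induction (Finset.univ : Finset (Fin r)) using Finset.induction_on with
    | empty => simp
    | insert a s ha ih => rw [Finset.sum_insert ha, Finset.prod_insert ha, zpow_add, ih]
  rw [this, ← Finset.prod_mul_distrib]
  refine Finset.prod_congr rfl fun m _ => ?_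
  rw [Tor_transfer F r hr hO ht hy hy' m m 1 (mu m) (by simp [zc])]
  generalize qh * qh = q
  rw [mul_zpow, ← zpow_mul]
  simp

theorem trans_eq (lam : Fin r → ℤ) : (fun z => z + zc r lam) = aff r 1 1 lam := by
  funext z m
  simp [aff, zc]

theorem Wtw_comp (hr : 0 < r) {O : Set (E r)} (hO : IsOrbit r O) {qh : Fˣ} {t : Fin r → Fˣ}
    (ht : t ∈ TOset F r qh O) (π π' : Equiv.Perm (Fin r)) (σ σ' : Fin r → ℤˣ)
    (lam lam' : Fin r → ℤ) (y : E r) (hy : y ∈ O) :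
    Wtw F r qh t (fun y => aff r π σ lam (aff r π' σ' lam' y)) (X F r y) =
      Wtw F r qh t (aff r π σ lam) (Wtw F r qh t (aff r π' σ' lam') (X F r y)) := by
  have e : (fun y => aff r π σ lam (aff r π' σ' lam' y)) = aff r (π' * π)
      (fun m => σ m * σ' (π m)) (fun m => (σ m : ℤ) * lam' (π m) + lam m) :=
    funext fun y => aff_comp r π π' σ σ' lam lam' y
  have e0 : aff r (π' * π) (fun m => σ m * σ' (π m)) 0 y = aff r π σ 0 (aff r π' σ' 0 y) := by
    rw [aff_comp]
    congr 1
    funext m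
    simp
  rw [e, Wtw_X, Wtw_X, map_smul, Wtw_X, smul_smul, e0]
  congr 1
  have hy' := orbit_aff r hr hO hy π' σ' 0
  rw [← upow_comp F r hr hO ht hy' π σ lam', ← Units.val_mul, ← mul_inv, ← upow_add]
  rfl

theorem Wtw_act (hr : 0 < r) {O : Set (E r)} (hO : IsOrbit r O) {qh : Fˣ} {t : Fin r → Fˣ}
    (ht : t ∈ TOset F r qh O) : ActProp F r qh O t (Wtw F r qh t) := by
  refine ⟨?_, ?_, ?_, ?_, ?_⟩
  · intro g g' hg hg'
    obtain ⟨π, σ, lam, rfl⟩ := IsW_exists r hr hg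
    obtain ⟨π', σ', lam', rfl⟩ := IsW_exists r hr hg'
    refine FO_ext F r _ (Wtw F r qh t (aff r π σ lam) * Wtw F r qh t (aff r π' σ' lam')) ?_
    intro y hy
    exact Wtw_comp F r hr hO ht π π' σ σ' lam lam' y hy
  · have e : (id : E r → E r) = aff r 1 1 0 := funext fun y => (aff_one r y).symm
    refine FO_ext F r _ 1 ?_
    intro y _
    rw [e, Wtw_X, aff_one]
    simp [upow]
  · intro l hl y _
    obtain ⟨π, σ, h⟩ := word_aff0 r l hl
    have e : (fun z => wordAct r l z) = aff r π σ 0 := funext h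
    rw [e, Wtw_X, h]
    simp [upow]
  · intro lam y _
    rw [trans_eq, Wtw_X, aff_one]
    rfl
  · intro g hg p hp
    obtain ⟨π, σ, lam, rfl⟩ := IsW_exists r hr hg
    refine FO_ext F r (Wtw F r qh t (aff r π σ lam) * LinearMap.mulLeft F p)
      (LinearMap.mulLeft F (LWact F r qh (aff r π σ lam) p) * Wtw F r qh t (aff r π σ lam)) ?_
    intro y hy
    show Wtw F r qh t (aff r π σ lam) (p * X F r y) =
      LWact F r qh (aff r π σ lam) p * Wtw F r qh t (aff r π σ lam) (X F r y)
    have key : ∀ p ∈ Lspan F r, (Wtw F r qh t (aff r π σ lam) * LinearMap.mulRight F (X F r y)) p =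
        (LinearMap.mulRight F (Wtw F r qh t (aff r π σ lam) (X F r y)) *
          LWact F r qh (aff r π σ lam)) p := by
      intro p hp
      refine LinearMap.eqOn_span ?_ hp
      rintro _ ⟨mu, rfl⟩
      show Wtw F r qh t (aff r π σ lam) (X F r (zc r mu) * X F r y) =
        LWact F r qh (aff r π σ lam) (X F r (zc r mu)) * Wtw F r qh t (aff r π σ lam) (X F r y)
      have hy' := orbit_aff r hr hO hy π σ 0
      have e1 : zc r mu + y = aff r 1 1 mu y := by
        funext m
        simp [aff, zc, add_comm]
      have e2 : aff r π σ 0 (zc r mu + y)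
          = aff r π σ 0 y + zc r (fun m => (σ m : ℤ) * mu (π m)) := by
        funext m
        simp [aff, zc]
        ring
      have hy2 : aff r π σ 0 y + zc r (fun m => (σ m : ℤ) * mu (π m)) ∈ O := by
        rw [← e2, e1]
        exact orbit_aff r hr hO (orbit_aff r hr hO hy _ _ _) _ _ _
      have e3 : aff r π σ 0 (zc r mu) + aff r π σ 0 y
          = aff r π σ 0 y + zc r (fun m => (σ m : ℤ) * mu (π m)) := by
        funext m
        simp [aff, zc]
        ring
      rw [X_mul, Wtw_X, Wtw_X, LWact_X, e2, smul_mul_smul_comm, X_mul, e3,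
        upow_shift F r hr hO ht hy' _ _ hy2]
      congr 1
      rw [← Units.val_mul, mul_inv, zpow_neg]
    exact key p hp

theorem Act_unique (hr : 0 < r) {O : Set (E r)} (hO : IsOrbit r O) {qh : Fˣ} {t : Fin r → Fˣ}
    (Θ : (E r → E r) → Module.End F (QA F r))
    (hΘ : ActProp F r qh O t Θ) (π : Equiv.Perm (Fin r)) (σ : Fin r → ℤˣ) (lam : Fin r → ℤ) :
    ∀ f ∈ FO F r O, Θ (aff r π σ lam) f = Wtw F r qh t (aff r π σ lam) f := by
  refine FO_ext F r _ _ ?_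
  intro y hy
  obtain ⟨h1, _, h3, h4, _⟩ := hΘ
  obtain ⟨l, hl, e⟩ := W0word_aff r π σ
  have e' : (fun z => wordAct r l z) = aff r π σ 0 := funext e
  have h5 := h3 l hl y hy
  rw [e', e] at h5
  have hX : X F r y ∈ FO F r O := Submodule.subset_span ⟨y, hy, rfl⟩
  have h6 := h1 _ _ (IsW_aff r 1 1 lam) (IsW_aff r π σ 0) _ hX
  have e2 : (fun y => aff r 1 1 lam (aff r π σ 0 y)) = aff r π σ lam := by
    funext y m
    simp [aff]
  have h7 := h4 lam _ (orbit_aff r hr hO hy π σ 0)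
  rw [trans_eq] at h7
  rw [e2, h5, h7] at h6
  rw [h6, Wtw_X]
  rfl

/-- There is a unique left `W`-action on `F[𝒪]` by `F`-linear maps with
`w_t(x^y) = x^{wy}` for `w ∈ W₀` and `τ(λ)_t(x^y) = (g_y t)^{-λ} x^y`, and it satisfies
`g_t(p·f) = (gp)·(g_t f)` for Laurent polynomials `p`. -/
theorem statement13 (F : Type*) [Field F] [CharZero F] (r : ℕ) (hr : 2 ≤ r)
    (qh : Fˣ) (O : Set (E r)) (hO : IsOrbit r O)
    (t : Fin r → Fˣ) (ht : t ∈ TOset F r qh O) :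
    ∃ Θ : (E r → E r) → Module.End F (QA F r), ActProp F r qh O t Θ ∧
      ∀ Θ' : (E r → E r) → Module.End F (QA F r), ActProp F r qh O t Θ' →
        ∀ g, IsWfun r g → ∀ f ∈ FO F r O, Θ' g f = Θ g f := by
  have hr0 : 0 < r := by omega
  refine ⟨Wtw F r qh t, Wtw_act F r hr0 hO ht, ?_⟩
  intro Θ' hΘ' g hg
  obtain ⟨π, σ, lam, rfl⟩ := IsW_exists r hr0 hg
  exact Act_unique F r hr0 hO Θ' hΘ' π σ lam

end QP

end
end

section
/- Fix k_0, u_0, k, k_r, u_r ∈ F^×, let j ∈ {0,…,r} and y ∈ ℝ^r. Set ᾱ_0 := −2ε_1, ᾱ_i := ε_i − ε_{i+1} (1 ≤ i < r), ᾱ_r := 2ε_r, with ᾱ_0^∨ := −ε_1, ᾱ_i^∨ := ε_i − ε_{i+1}, ᾱ_r^∨ := ε_r, and let c_0 := u_0u_r, c_i := k² for 1 ≤ i < r, and c_r := k_0k_r. For s ∈ (F^×)^r and λ ∈ ℤ^r write s^λ := s_1^{λ_1}⋯s_r^{λ_r}, let W_0 act on (F^×)^r by permuting and inverting coordinates (so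 that (ws)^λ = s^{w^{−1}λ}), and write ᾱ_j(λ) := ⟨ᾱ_j, λ⟩. Then: (1) if s_jy = y (for the affine W-action on ℝ^r), then 𝔰_y^{ᾱ_j^∨} = c_j^{−1}, and (s_{ᾱ_j}𝔰_y)^λ = c_j^{ᾱ_j(λ)}·𝔰_y^λ for all λ ∈ ℤ^r, where s_{ᾱ_j} ∈ W_0 is the reflection in ᾱ_j (with s_{ᾱ_0} = s_{ε_1}); (2) if s_jy ≠ y, then s_{ᾱ_j}𝔰_y = 𝔰_{s_jy}. -/
open scoped Classical

noncomputable section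

namespace QP

variable (F : Type*) [Field F] [CharZero F] (r : ℕ)

theorem etaE_neg {z : ℝ} (hz : z ≠ 0) : etaE (-z) = -etaE z := by
  unfold etaE
  by_cases h : ∃ n : ℤ, z = 2 * n
  · obtain ⟨n, hn⟩ := h
    have h1 : ∃ n : ℤ, z = 2 * n := ⟨n, hn⟩
    have h2 : ∃ n : ℤ, -z = 2 * n := ⟨-n, by push_cast; linarith⟩
    rw [if_pos h1, if_pos h2]
    have hn0 : n ≠ 0 := by rintro rfl; apply hz; simpa using hn
    rcases lt_or_gt_of_ne hn0 with h | h
    · have : (n : ℝ) ≤ -1 := by exact_mod_cast (by omega : n ≤ -1)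
      rw [if_pos (by linarith), if_neg (by linarith)]; rfl
    · have : (1 : ℝ) ≤ n := by exact_mod_cast h
      rw [if_neg (by linarith), if_pos (by linarith)]
  · have h2 : ¬ ∃ n : ℤ, -z = 2 * n := by
      rintro ⟨n, hn⟩; exact h ⟨-n, by push_cast; linarith⟩
    rw [if_neg h, if_neg h2]; rfl

theorem etaO_neg (z : ℝ) : etaO (-z) = -etaO z := by
  unfold etaO
  by_cases h : ∃ n : ℤ, z = 2 * n + 1
  · obtain ⟨n, hn⟩ := h
    have h1 : ∃ n : ℤ, z = 2 * n + 1 := ⟨n, hn⟩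
    have h2 : ∃ n : ℤ, -z = 2 * n + 1 := ⟨-n - 1, by push_cast; linarith⟩
    rw [if_pos h1, if_pos h2]
    rcases lt_or_ge n 0 with h | h
    · have : (n : ℝ) ≤ -1 := by exact_mod_cast (by omega : n ≤ -1)
      rw [if_pos (by linarith), if_neg (by linarith)]; rfl
    · have : (0 : ℝ) ≤ n := by exact_mod_cast h
      rw [if_neg (by linarith), if_pos (by linarith)]
  · have h2 : ¬ ∃ n : ℤ, -z = 2 * n + 1 := by
      rintro ⟨n, hn⟩; exact h ⟨-n - 1, by push_cast; linarith⟩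
    rw [if_neg h, if_neg h2]; rfl

theorem etaE_two_sub (z : ℝ) : etaE (2 - z) = -etaE z := by
  unfold etaE
  by_cases h : ∃ n : ℤ, z = 2 * n
  · obtain ⟨n, hn⟩ := h
    have h1 : ∃ n : ℤ, z = 2 * n := ⟨n, hn⟩
    have h2 : ∃ n : ℤ, 2 - z = 2 * n := ⟨1 - n, by push_cast; linarith⟩
    rw [if_pos h1, if_pos h2]
    rcases le_or_gt n 0 with h | h
    · have : (n : ℝ) ≤ 0 := by exact_mod_cast h
      rw [if_pos (by linarith), if_neg (by linarith)]; rfl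
    · have : (1 : ℝ) ≤ n := by exact_mod_cast h
      rw [if_neg (by linarith), if_pos (by linarith)]
  · have h2 : ¬ ∃ n : ℤ, 2 - z = 2 * n := by
      rintro ⟨n, hn⟩; exact h ⟨1 - n, by push_cast; linarith⟩
    rw [if_neg h, if_neg h2]; rfl

theorem etaO_two_sub {z : ℝ} (hz : z ≠ 1) : etaO (2 - z) = -etaO z := by
  unfold etaO
  by_cases h : ∃ n : ℤ, z = 2 * n + 1
  · obtain ⟨n, hn⟩ := h
    have h1 : ∃ n : ℤ, z = 2 * n + 1 := ⟨n, hn⟩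
    have h2 : ∃ n : ℤ, 2 - z = 2 * n + 1 := ⟨-n, by push_cast; linarith⟩
    rw [if_pos h1, if_pos h2]
    have hn0 : n ≠ 0 := by rintro rfl; apply hz; simpa using hn
    rcases lt_or_gt_of_ne hn0 with h | h
    · have : (n : ℝ) ≤ -1 := by exact_mod_cast (by omega : n ≤ -1)
      rw [if_pos (by linarith), if_neg (by linarith)]; rfl
    · have : (1 : ℝ) ≤ n := by exact_mod_cast h
      rw [if_neg (by linarith), if_pos (by linarith)]
  · have h2 : ¬ ∃ n : ℤ, 2 - z = 2 * n + 1 := by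
      rintro ⟨n, hn⟩; exact h ⟨-n, by push_cast; linarith⟩
    rw [if_neg h, if_neg h2]; rfl

theorem eta_neg {z : ℝ} (hz : z ≠ 0) : eta (-z) = -eta z := by
  unfold eta; rw [etaE_neg hz, etaO_neg]; ring

theorem eta_eq (z : ℝ) :
    eta z = if ∃ n : ℤ, z = n then (if 0 < z then 1 else -1) else 0 := by
  unfold eta etaE etaO
  by_cases h : ∃ n : ℤ, z = n
  · obtain ⟨n, hn⟩ := h
    have h1 : ∃ n : ℤ, z = n := ⟨n, hn⟩
    rw [if_pos h1]
    rcases Int.even_or_odd' n with ⟨m, hm | hm⟩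
    · have h2 : ∃ n : ℤ, z = 2 * n := ⟨m, by rw [hn, hm]; push_cast; ring⟩
      have h3 : ¬ ∃ n : ℤ, z = 2 * n + 1 := by
        rintro ⟨l, hl⟩
        rw [hn] at hl
        have : n = 2 * l + 1 := by exact_mod_cast hl
        omega
      rw [if_pos h2, if_neg h3, add_zero]
      subst hn
      congr 1
      apply propext
      constructor
      · intro h; linarith
      · intro h
        have : 0 < n := by exact_mod_cast h
        exact_mod_cast (by omega : 2 ≤ n)
    · have h2 : ∃ n : ℤ, z = 2 * n + 1 := ⟨m, by rw [hn, hm]; push_cast; ring⟩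
      have h3 : ¬ ∃ n : ℤ, z = 2 * n := by
        rintro ⟨l, hl⟩
        rw [hn] at hl
        have : n = 2 * l := by exact_mod_cast hl
        omega
      rw [if_pos h2, if_neg h3, zero_add]
      subst hn
      congr 1
      apply propext
      constructor
      · intro h; linarith
      · intro h
        have : 0 < n := by exact_mod_cast h
        exact_mod_cast (by omega : 1 ≤ n)
  · have h2 : ¬ ∃ n : ℤ, z = 2 * n := by
      rintro ⟨n, hn⟩; exact h ⟨2 * n, by push_cast; linarith⟩
    have h3 : ¬ ∃ n : ℤ, z = 2 * n + 1 := by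
      rintro ⟨n, hn⟩; exact h ⟨2 * n + 1, by push_cast; linarith⟩
    rw [if_neg h, if_neg h2, if_neg h3]; rfl

theorem eta_one_sub (z : ℝ) : eta (1 - z) = -eta z := by
  rw [eta_eq, eta_eq]
  by_cases h : ∃ n : ℤ, z = n
  · obtain ⟨n, hn⟩ := h
    have h1 : ∃ n : ℤ, z = n := ⟨n, hn⟩
    have h2 : ∃ n : ℤ, 1 - z = n := ⟨1 - n, by push_cast; linarith⟩
    rw [if_pos h1, if_pos h2]
    rcases le_or_gt n 0 with h | h
    · have : (n : ℝ) ≤ 0 := by exact_mod_cast h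
      rw [if_pos (by linarith), if_neg (by linarith)]; rfl
    · have : (1 : ℝ) ≤ n := by exact_mod_cast h
      rw [if_neg (by linarith), if_pos (by linarith)]
  · have h2 : ¬ ∃ n : ℤ, 1 - z = n := by
      rintro ⟨n, hn⟩; exact h ⟨1 - n, by push_cast; linarith⟩
    rw [if_neg h, if_neg h2]; rfl

theorem eta_zero : eta 0 = -1 := by
  rw [eta_eq, if_pos ⟨0, by simp⟩]; simp

/-- The contribution of a pair of indices to `m_i(y)`. -/
def pf {r : ℕ} (m l : Fin r) (a b : ℝ) : ℤ :=
  if m < l then eta (a - b) + eta (a + b)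
  else if l < m then eta (b + a) - eta (b - a) else 0

theorem nO_eq (r : ℕ) (y : E r) (m : Fin r) : nO r y m = ∑ l, pf m l (y m) (y l) := by
  unfold nO pf
  rw [← Finset.sum_add_distrib]
  refine Finset.sum_congr rfl fun l _ => ?_
  rcases lt_trichotomy m l with h | h | h
  · simp [h, h.not_gt]
  · simp [h]
  · simp [h, h.not_gt]

theorem tcU_eq (F : Type*) [Field F] (r : ℕ) (t : Fin r → Fˣ) (a : Fin r) (i : ℕ)
    (h : (a : ℕ) + 1 = i) : tcU F r t i = t a := by
  subst h
  unfold tcU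
  rw [Finset.prod_eq_single a]
  · simp
  · intro b _ hb
    rw [if_neg]
    intro h; apply hb; ext; omega
  · simp

theorem cd_eq (r : ℕ) (y : E r) (a : Fin r) (i : ℕ)
    (h : (a : ℕ) + 1 = i) : cd r y i = y a := by
  subst h
  unfold cd
  rw [Finset.sum_eq_single a]
  · simp
  · intro b _ hb
    rw [if_neg]
    intro h; apply hb; ext; omega
  · simp

theorem genF_swap (r : ℕ) (y : E r) (a b : Fin r) (h : (a : ℕ) + 1 = b) :
    genF r b y = fun m => y (Equiv.swap a b m) := by
  have hb := b.2
  funext m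
  unfold genF sW
  rw [if_neg (by omega), if_neg (by omega), cd_eq r y b _ rfl, cd_eq r y a _ h]
  by_cases h1 : m = a
  · subst h1; simp [h]
  · by_cases h2 : m = b
    · subst h2; simp
    · rw [Equiv.swap_apply_of_ne_of_ne h1 h2, if_neg, if_neg]
      · intro h; apply h2; ext; exact h
      · intro h'; apply h1; ext; omega

theorem sTor_swap (F : Type*) [Field F] (r : ℕ) (t : Fin r → Fˣ) (a b : Fin r)
    (h : (a : ℕ) + 1 = b) : sTor F r b t = fun m => t (Equiv.swap a b m) := by
  have hb := b.2
  funext m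
  unfold sTor
  rw [if_neg (by omega), if_neg (by omega), tcU_eq F r t b _ rfl, tcU_eq F r t a _ h]
  by_cases h1 : m = a
  · subst h1; simp [h]
  · by_cases h2 : m = b
    · subst h2; simp
    · rw [Equiv.swap_apply_of_ne_of_ne h1 h2, if_neg, if_neg]
      · intro h; apply h2; ext; exact h
      · intro h'; apply h1; ext; omega

/-- Adjacent transpositions preserve the order of all other pairs. -/
theorem swap_lt {r : ℕ} (a b : Fin r) (h : (a : ℕ) + 1 = b) (p l : Fin r)
    (h1 : ¬ (p = a ∧ l = b)) (h2 : ¬ (p = b ∧ l = a)) :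
    Equiv.swap a b p < Equiv.swap a b l ↔ p < l := by
  rw [Equiv.swap_apply_def, Equiv.swap_apply_def]
  simp only [Fin.lt_def, Fin.ext_iff] at *
  split_ifs <;> simp_all <;> omega

theorem pf_swap {r : ℕ} (a b : Fin r) (h : (a : ℕ) + 1 = b) (p l : Fin r) (u v : ℝ)
    (h1 : ¬ (p = a ∧ l = b)) (h2 : ¬ (p = b ∧ l = a)) :
    pf (Equiv.swap a b p) (Equiv.swap a b l) u v = pf p l u v := by
  unfold pf
  simp only [swap_lt a b h p l h1 h2,
    swap_lt a b h l p (fun h => h2 ⟨h.2, h.1⟩) (fun h => h1 ⟨h.2, h.1⟩)]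

theorem nO_swap (r : ℕ) (y : E r) (a b : Fin r) (h : (a : ℕ) + 1 = b) (hne : y a ≠ y b)
    (m : Fin r) :
    nO r (fun m => y (Equiv.swap a b m)) m = nO r y (Equiv.swap a b m) := by
  have hab : a < b := by rw [Fin.lt_def]; omega
  obtain ⟨p, rfl⟩ : ∃ p, m = Equiv.swap a b p := ⟨Equiv.swap a b m, by simp⟩
  rw [nO_eq, nO_eq, ← Equiv.sum_comp (Equiv.swap a b)]
  simp only [Equiv.swap_apply_self]
  refine Finset.sum_congr rfl fun l _ => ?_
  by_cases h1 : p = a ∧ l = b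
  · obtain ⟨rfl, rfl⟩ := h1
    have := eta_neg (sub_ne_zero.2 hne)
    rw [neg_sub] at this
    simp [pf, hab, hab.not_gt, this, add_comm]
  by_cases h2 : p = b ∧ l = a
  · obtain ⟨rfl, rfl⟩ := h2
    have := eta_neg (sub_ne_zero.2 hne)
    rw [neg_sub] at this
    simp [pf, hab, hab.not_gt, this, add_comm]
    ring
  exact pf_swap a b h p l _ _ h1 h2

theorem nO_swap_fix (r : ℕ) (y : E r) (a b : Fin r) (h : (a : ℕ) + 1 = b) (he : y a = y b) :
    nO r y a = nO r y b - 2 := by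
  have hab : a < b := by rw [Fin.lt_def]; omega
  have hy : ∀ l, y (Equiv.swap a b l) = y l := by
    intro l
    rw [Equiv.swap_apply_def]
    split_ifs with h1 h2
    · rw [h1, he]
    · rw [h2, he]
    · rfl
  rw [nO_eq, nO_eq, ← Equiv.sum_comp (Equiv.swap a b) (fun l => pf b l (y b) (y l)),
    sub_eq_add_neg]
  have : (-2 : ℤ) = ∑ l : Fin r, if l = b then -2 else 0 := by simp
  rw [this, ← Finset.sum_add_distrib]
  refine Finset.sum_congr rfl fun l _ => ?_
  rw [hy]
  split_ifs with hl
  · subst hl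
    simp [pf, hab, hab.not_gt, he, eta_zero]
    ring
  · have := pf_swap a b h a l (y b) (y l) (fun h => hl h.2) (fun h => hab.ne h.1)
    rw [Equiv.swap_apply_left] at this
    rw [this, he, add_zero]

/-- If the twisted coordinates agree, so do all the monomials. -/
theorem upow_of_coord (F : Type*) [Field F] (r : ℕ) (t s : Fin r → Fˣ) (c : Fˣ)
    (a : Fin r → ℤ) (h : ∀ m, s m = c ^ a m * t m) (lam : Fin r → ℤ) :
    upow F r s lam = c ^ (∑ m, a m * lam m) * upow F r t lam := by
  unfold upow
  have : c ^ (∑ m, a m * lam m) = ∏ m, c ^ (a m * lam m) := by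
    induction (Finset.univ : Finset (Fin r)) using Finset.induction_on with
    | empty => simp
    | insert x s hx ih => rw [Finset.sum_insert hx, Finset.prod_insert hx, zpow_add, ih]
  rw [this, ← Finset.prod_mul_distrib]
  refine Finset.prod_congr rfl fun m _ => ?_
  rw [h, mul_zpow, zpow_mul]

theorem nO_first_fix (r : ℕ) (y : E r) (a : Fin r) (ha : (a : ℕ) = 0) (hy : y a = 1 / 2) :
    nO r y a = 0 := by
  rw [nO_eq]
  refine Finset.sum_eq_zero fun l _ => ?_
  unfold pf
  rw [hy]
  have h2 : ¬ l < a := by rw [Fin.lt_def]; omega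
  rw [if_neg h2]
  split_ifs
  · have := eta_one_sub (1 / 2 + y l)
    rw [show (1 : ℝ) - (1 / 2 + y l) = 1 / 2 - y l by ring] at this
    rw [this]; ring
  · rfl

theorem nO_last_fix (r : ℕ) (y : E r) (a : Fin r) (ha : (a : ℕ) + 1 = r) (hy : y a = 0) :
    nO r y a = 0 := by
  rw [nO_eq]
  refine Finset.sum_eq_zero fun l _ => ?_
  unfold pf
  rw [hy]
  have h2 : ¬ a < l := by rw [Fin.lt_def]; omega
  rw [if_neg h2]
  split_ifs <;> simp

theorem nO_first (r : ℕ) (y : E r) (m : Fin r) :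
    nO r (fun m => if (m : ℕ) = 0 then 1 - y m else y m) m
      = if (m : ℕ) = 0 then - nO r y m else nO r y m := by
  have key : ∀ u v : ℝ, eta (1 - u - v) = - eta (u + v) ∧ eta (1 - u + v) = - eta (u - v) := by
    intro u v
    rw [← eta_one_sub, ← eta_one_sub]
    constructor <;> congr 1 <;> ring
  rw [nO_eq, nO_eq]
  split_ifs with hm
  · rw [← Finset.sum_neg_distrib]
    refine Finset.sum_congr rfl fun l _ => ?_
    unfold pf
    have h2 : ¬ l < m := by rw [Fin.lt_def]; omega
    rw [if_neg h2, if_neg h2]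
    by_cases h : m < l
    · have hl : (l : ℕ) ≠ 0 := by rw [Fin.lt_def] at h; omega
      simp only [h, if_true, hl, if_false, (key _ _).1, (key _ _).2]
      ring
    · simp [h]
  · refine Finset.sum_congr rfl fun l _ => ?_
    split_ifs with hl
    · have h1 : l < m := by rw [Fin.lt_def]; omega
      simp only [pf, h1, h1.not_gt, if_true, if_false, (key _ _).1, (key _ _).2]
      ring
    · rfl

theorem nO_last (r : ℕ) (y : E r) (m : Fin r) :
    nO r (fun m => if (m : ℕ) + 1 = r then - y m else y m) m
      = if (m : ℕ) + 1 = r then - nO r y m else nO r y m := by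
  rw [nO_eq, nO_eq]
  split_ifs with hm
  · rw [← Finset.sum_neg_distrib]
    refine Finset.sum_congr rfl fun l _ => ?_
    unfold pf
    have h2 : ¬ m < l := by rw [Fin.lt_def]; omega
    rw [if_neg h2, if_neg h2]
    by_cases h : l < m
    · have hl : (l : ℕ) + 1 ≠ r := by rw [Fin.lt_def] at h; omega
      simp only [h, if_true, hl, if_false, sub_neg_eq_add, ← sub_eq_add_neg]
      ring
    · simp [h]
  · refine Finset.sum_congr rfl fun l _ => ?_
    split_ifs with hl
    · have h1 : m < l := by rw [Fin.lt_def]; omega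
      simp only [pf, h1, if_true, sub_neg_eq_add, ← sub_eq_add_neg]
      ring
    · rfl

theorem upow_single (F : Type*) [Field F] (r : ℕ) (t : Fin r → Fˣ) (v : Fin r → ℤ) (a : Fin r)
    (h : ∀ m, m ≠ a → v m = 0) : upow F r t v = t a ^ v a := by
  unfold upow
  rw [Finset.prod_eq_single a]
  · intro b _ hb; rw [h b hb, zpow_zero]
  · simp

theorem upow_pair (F : Type*) [Field F] (r : ℕ) (t : Fin r → Fˣ) (v : Fin r → ℤ) (a b : Fin r)
    (hab : a ≠ b) (h : ∀ m, m ≠ a → m ≠ b → v m = 0) :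
    upow F r t v = t a ^ v a * t b ^ v b := by
  unfold upow
  rw [← Finset.prod_pair hab (f := fun m => t m ^ v m)]
  symm
  apply Finset.prod_subset (Finset.subset_univ _)
  intro m _ hm
  simp only [Finset.mem_insert, Finset.mem_singleton, not_or] at hm
  rw [h m hm.1 hm.2, zpow_zero]


/-- Behaviour of `𝔰_y` under the simple reflections: if `s_j y = y`
then `𝔰_y^{ᾱ_j^∨} = c_j⁻¹` and `(s_{ᾱ_j} 𝔰_y)^λ = c_j^{ᾱ_j(λ)} 𝔰_y^λ`; if `s_j y ≠ y`
then `s_{ᾱ_j} 𝔰_y = 𝔰_{s_j y}`. -/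
theorem statement14 (F : Type*) [Field F] [CharZero F] (r : ℕ) (hr : 2 ≤ r)
    (k0 u0 k kr ur : Fˣ) (j : ℕ) (hj : j ≤ r) (y : E r) :
    (genF r j y = y →
      upow F r (sfrak F r k0 u0 k kr ur y) (abarV r j) = (cpar F r k0 u0 k kr ur j)⁻¹ ∧
      ∀ lam : Fin r → ℤ,
        upow F r (sTor F r j (sfrak F r k0 u0 k kr ur y)) lam
          = cpar F r k0 u0 k kr ur j ^ (∑ m : Fin r, abarI r j m * lam m) *
              upow F r (sfrak F r k0 u0 k kr ur y) lam) ∧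
    (genF r j y ≠ y →
      sTor F r j (sfrak F r k0 u0 k kr ur y) = sfrak F r k0 u0 k kr ur (genF r j y)) := by
  rcases Nat.eq_zero_or_pos j with rfl | hj0
  · -- j = 0
    let a : Fin r := ⟨0, by omega⟩
    have hg : genF r 0 y = fun m : Fin r => if (m : ℕ) = 0 then 1 - y m else y m := by simp [genF]
    have ha : ∀ m : Fin r, (m : ℕ) = 0 ↔ m = a := fun m => by simp [a, Fin.ext_iff]
    have hne : genF r 0 y = y ↔ y a = 1 / 2 := by
      rw [hg, funext_iff]
      constructor
      · intro h
        have := h a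
        simp only [a, if_true] at this ⊢
        linarith
      · intro h m
        split_ifs with hm
        · rw [(ha m).1 hm, h]; norm_num
        · rfl
    constructor
    · intro h
      have hy := hne.1 h
      have hs : sfrak F r k0 u0 k kr ur y a = u0 * ur := by
        unfold sfrak
        rw [nO_first_fix r y a rfl hy, hy, show (2 : ℝ) * (1 / 2) = 1 by norm_num]
        have h1 : etaO 1 = 1 := by
          unfold etaO
          rw [if_pos ⟨0, by norm_num⟩]; simp
        have h2 : etaE 1 = 0 := by
          have := eta_one_sub 0
          rw [sub_zero, eta_zero] at this
          unfold eta at this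
          omega
        simp [h1, h2]
      constructor
      · rw [upow_single F r _ _ a, hs]
        · simp [abarV, cpar, a]
        · intro m hm
          simp [abarV, (ha m).not.2 hm]
      · refine upow_of_coord F r _ _ _ _ fun m => ?_
        by_cases hm : m = a
        · subst hm
          simp only [sTor, abarI, cpar, if_true, hs, a]
          generalize u0 * ur = c
          rw [zpow_neg, zpow_ofNat, pow_two, mul_inv, inv_mul_cancel_right]
        · simp [sTor, abarI, (ha m).not.2 hm]
    · intro h
      have hy := hne.not.1 h
      funext m
      rw [hg]
      unfold sfrak
      simp only [sTor, nO_first, if_true]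
      split_ifs with hm
      · have hm' := (ha m).1 hm
        rw [show (2 : ℝ) * (1 - y m) = 2 - 2 * y m by ring, etaE_two_sub, etaO_two_sub]
        · simp only [zpow_neg, mul_inv]
        · rw [hm']; intro h; apply hy; linarith
      · rfl
  rcases Nat.lt_or_ge j r with hjr | hjr
  · -- 1 ≤ j < r
    let a : Fin r := ⟨j - 1, by omega⟩
    obtain ⟨b, hb⟩ : ∃ b : Fin r, (b : ℕ) = j := ⟨⟨j, hjr⟩, rfl⟩
    have hab : (a : ℕ) + 1 = b := by simp only [a]; omega
    clear_value a
    subst hb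
    have hne' : a ≠ b := by intro h; rw [h] at hab; omega
    have hg := genF_swap r y a b hab
    have hne : genF r b y = y ↔ y a = y b := by
      rw [hg, funext_iff]
      constructor
      · intro h
        have := h b
        simpa using this
      · intro he l
        rw [Equiv.swap_apply_def]
        split_ifs with h1 h2
        · rw [h1, he]
        · rw [h2, he]
        · rfl
    have hma : ∀ m : Fin r, (m : ℕ) + 1 = b ↔ m = a := fun m => by
      rw [Fin.ext_iff]; omega
    have hmb : ∀ m : Fin r, (m : ℕ) = b ↔ m = b := fun m => by
      rw [Fin.ext_iff]
    have hb0 : (b : ℕ) ≠ 0 := by omega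
    have hbr : (b : ℕ) ≠ r := by omega
    constructor
    · intro h
      have hy := hne.1 h
      have hs : sfrak F r k0 u0 k kr ur y b = (k * k) * sfrak F r k0 u0 k kr ur y a := by
        unfold sfrak
        rw [nO_swap_fix r y a b hab hy, hy, zpow_sub]
        rw [show k ^ (2 : ℤ) = k * k by rw [zpow_ofNat, pow_two]]
        rw [mul_left_comm, mul_comm (k * k), mul_assoc (k ^ nO r y b), inv_mul_cancel, mul_one]
      constructor
      · rw [upow_pair F r _ _ a b hne', hs]
        · simp [abarV, cpar, hb0, hbr, hab]
        · intro m h1 h2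
          simp [abarV, hb0, hbr, hma, hmb, h1, h2]
      · refine upow_of_coord F r _ _ _ _ fun m => ?_
        rw [sTor_swap F r _ a b hab]
        by_cases h1 : m = a
        · subst h1
          simp [abarI, cpar, hb0, hbr, hab, hs]
        · by_cases h2 : m = b
          · subst h2
            simp only [abarI, cpar, hb0, hbr, hs, if_false, if_true, Equiv.swap_apply_right,
              Nat.succ_ne_self]
            rw [zpow_neg, zpow_one, inv_mul_cancel_left]
          · simp [abarI, hb0, hbr, hma, hmb, h1, h2, Equiv.swap_apply_of_ne_of_ne h1 h2]
    · intro h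
      have hy := hne.not.1 h
      rw [sTor_swap F r _ a b hab, hg]
      funext m
      simp only [sfrak, nO_swap r y a b hab hy]
  · -- j = r
    obtain rfl : j = r := le_antisymm hj hjr
    let a : Fin j := ⟨j - 1, by omega⟩
    have hj0' : j ≠ 0 := by omega
    have hg : genF j j y = fun m : Fin j => if (m : ℕ) + 1 = j then - y m else y m := by
      funext m
      simp [genF, sW, hj0']
    have haj : (a : ℕ) + 1 = j := by simp only [a]; omega
    clear_value a
    have ha : ∀ m : Fin j, (m : ℕ) + 1 = j ↔ m = a := fun m => by rw [Fin.ext_iff]; omega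
    have hne : genF j j y = y ↔ y a = 0 := by
      rw [hg, funext_iff]
      constructor
      · intro h
        have := h a
        rw [if_pos haj] at this
        linarith
      · intro h m
        split_ifs with hm
        · rw [(ha m).1 hm, h]; norm_num
        · rfl
    constructor
    · intro h
      have hy := hne.1 h
      have hs : sfrak F j k0 u0 k kr ur y a = (k0 * kr)⁻¹ := by
        unfold sfrak
        rw [nO_last_fix j y a haj hy, hy, mul_zero]
        have h1 : etaE 0 = -1 := by
          unfold etaE
          rw [if_pos ⟨0, by norm_num⟩]; simp
        have h2 : etaO 0 = 0 := by
          have := etaO_neg 0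
          rw [neg_zero] at this
          omega
        simp [h1, h2]
      constructor
      · rw [upow_single F j _ _ a, hs]
        · simp [abarV, cpar, haj, hj0']
        · intro m hm
          simp [abarV, (ha m).not.2 hm, hj0']
      · refine upow_of_coord F j _ _ _ _ fun m => ?_
        by_cases hm : m = a
        · subst hm
          simp only [sTor, abarI, cpar, if_true, hj0', if_false, haj]
          rw [hs, inv_inv, zpow_ofNat, pow_two, mul_inv_cancel_right]
        · simp [sTor, abarI, (ha m).not.2 hm, hj0']
    · intro h
      have hy := hne.not.1 h
      funext m
      rw [hg]
      unfold sfrak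
      simp only [sTor, nO_last, if_true, hj0', if_false]
      split_ifs with hm
      · have hm' := (ha m).1 hm
        rw [show (2 : ℝ) * (- y m) = - (2 * y m) by ring, etaE_neg, etaO_neg]
        · simp only [zpow_neg, mul_inv]
        · rw [hm']; intro h; apply hy; linarith
      · rfl

end QP

end
end
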